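/- arXiv:1507.01505 — 5 statements merged into one kernel-verified Lean document; each statement's English description precedes it below -/
import Mathlib

section
/- For every L ≥ 2 there exists a positive constant C(L), depending only on L, such that for every doubling 2π-periodic weight function W with doubling constant L, every integer n ≥ 1, and every trigonometric polynomial p of degree at most n: ∫_{-π}^{π} |p(θ)| W_n(θ)dθ ≤ C(L) ∫_{-π}^{π} |p(θ)| W(θ)dθ, where W_n(x) := n ∫_{x-1/n}^{x+1/n} W(θ)dθ. -/
open MeasureTheory Real Set

noncomputable section

/-- A trigonometric polynomial of degree at most `n`. -/
def IsTrigPoly (n : ℕ) (p : ℝ → ℝ) : Prop :=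
  ∃ a b : ℕ → ℝ, ∀ θ : ℝ,
    p θ = a 0 + ∑ k ∈ Finset.Icc 1 n, (a k * Real.cos (k * θ) + b k * Real.sin (k * θ))

/-- A `2π`-periodic weight function. -/
def IsPeriodicWeight (W : ℝ → ℝ) : Prop :=
  Measurable W ∧ (∀ θ, 0 ≤ W θ) ∧ Function.Periodic W (2 * π) ∧
  IntervalIntegrable W volume (-π) π ∧ 0 < ∫ θ in (-π)..π, W θ

/-- `W` is doubling with doubling constant `L`. -/
def IsDoublingPeriodic (W : ℝ → ℝ) (L : ℝ) : Prop :=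
  ∀ δ : ℝ, 0 < δ → ∀ a : ℝ,
    (∫ θ in (a - 2*δ)..(a + 2*δ), W θ) ≤ L * ∫ θ in (a - δ)..(a + δ), W θ

open scoped SchwartzMap FourierTransform ENNReal

/-- There is a Schwartz function whose Fourier transform equals `1` on `[-1, 1]`. -/
theorem exists_schwartzMap_integral_exp_mul_eq_one :
    ∃ φ : 𝓢(ℝ, ℂ), ∀ s : ℝ, |s| ≤ 1 →
      ∫ u, Complex.exp (((s * u : ℝ) : ℂ) * Complex.I) * φ u = 1 := by
  let χ : ContDiffBump (0 : ℝ) := ⟨1, 2, one_pos, one_lt_two⟩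
  have hsupp : HasCompactSupport (fun x : ℝ => (χ x : ℂ)) :=
    χ.hasCompactSupport.comp_left Complex.ofReal_zero
  have hsmooth : ContDiff ℝ ((⊤ : ℕ∞) : WithTop ℕ∞) (fun x : ℝ => (χ x : ℂ)) :=
    Complex.ofRealCLM.contDiff.comp χ.contDiff
  refine ⟨𝓕⁻ (hsupp.toSchwartzMap hsmooth), fun s hs => ?_⟩
  have hF : 𝓕 (𝓕⁻ (hsupp.toSchwartzMap hsmooth)) (-(s / (2 * π))) = (1 : ℂ) := by
    rw [FourierTransform.fourier_fourierInv_eq]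
    have : -(s / (2 * π)) ∈ Metric.closedBall (0 : ℝ) χ.rIn := by
      have h2 : (1 : ℝ) ≤ 2 * π := by linarith [pi_gt_three]
      have : |s| / (2 * π) ≤ 1 := by
        rw [div_le_one (by positivity)]; linarith
      simpa [χ, abs_div, abs_of_pos pi_pos] using this
    simpa using χ.one_of_mem_closedBall this
  rw [SchwartzMap.fourier_coe, Real.fourier_real_eq_integral_exp_smul] at hF
  rw [← hF]
  refine integral_congr_ae (Filter.Eventually.of_forall fun u => ?_)
  have : s * u = -2 * π * u * -(s / (2 * π)) := by field_simp
  simp only [smul_eq_mul, this]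

/-- The increments of a Schwartz function over steps of length at most one decay rapidly. -/
theorem SchwartzMap.exists_norm_sub_le_mul_inv_one_add_pow (φ : 𝓢(ℝ, ℂ)) (r : ℕ) :
    ∃ C, 0 ≤ C ∧ ∀ u v : ℝ, |v - u| ≤ 1 →
      ‖φ v - φ u‖ ≤ C * ((1 + |u|) ^ r)⁻¹ * |v - u| := by
  obtain ⟨C, hC⟩ : ∃ C, ∀ x, (1 + ‖x‖) ^ r * ‖deriv φ x‖ ≤ C := by
    have h := SchwartzMap.one_add_le_sup_seminorm_apply (𝕜 := ℝ) (m := (r, 1)) (k := r) (n := 1)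
      le_rfl le_rfl φ
    simp only [norm_iteratedFDeriv_one, ← norm_deriv_eq_norm_fderiv] at h
    exact ⟨_, h⟩
  have hC0 : 0 ≤ C := le_trans (by positivity) (hC 0)
  refine ⟨2 ^ r * C, by positivity, fun u v huv => ?_⟩
  refine Convex.norm_image_sub_le_of_norm_deriv_le (s := uIcc u v)
    (fun x _ => φ.differentiableAt) (fun x hx => ?_) (convex_uIcc u v)
    left_mem_uIcc right_mem_uIcc
  have hxu : |x - u| ≤ 1 := (abs_sub_left_of_mem_uIcc hx).trans huv
  have hu : 1 + |u| ≤ 2 * (1 + |x|) := by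
    have := abs_sub_abs_le_abs_sub u x
    rw [abs_sub_comm] at this
    linarith [abs_nonneg x]
  have h1 : (1 + |u|) ^ r ≤ 2 ^ r * (1 + |x|) ^ r := by
    rw [← mul_pow]; gcongr
  rw [← div_eq_mul_inv, le_div_iff₀ (by positivity)]
  calc ‖deriv φ x‖ * (1 + |u|) ^ r ≤ ‖deriv φ x‖ * (2 ^ r * (1 + |x|) ^ r) := by gcongr
    _ = 2 ^ r * ((1 + ‖x‖) ^ r * ‖deriv φ x‖) := by rw [Real.norm_eq_abs]; ring
    _ ≤ 2 ^ r * C := by gcongr; exact hC x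

theorem IsTrigPoly.continuous {n : ℕ} {p : ℝ → ℝ} (hp : IsTrigPoly n p) : Continuous p := by
  obtain ⟨a, b, hp⟩ := hp
  rw [funext hp]
  fun_prop

theorem IsTrigPoly.periodic {n : ℕ} {p : ℝ → ℝ} (hp : IsTrigPoly n p) :
    Function.Periodic p (2 * π) := by
  obtain ⟨a, b, hp⟩ := hp
  intro x
  rw [hp, hp]
  congr 1
  refine Finset.sum_congr rfl fun k _ => ?_
  rw [mul_add, Real.cos_add_nat_mul_two_pi, Real.sin_add_nat_mul_two_pi]

/-- Convolution with the dilate `n * φ (n * ·)` reproduces `F`. -/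
def IsReproducedBy (φ : 𝓢(ℝ, ℂ)) (n : ℕ) (F : ℝ → ℂ) : Prop :=
  ∀ x, Integrable (fun u => F (x - u / n) * φ u) ∧ ∫ u, F (x - u / n) * φ u = F x

namespace IsReproducedBy

variable {φ : 𝓢(ℝ, ℂ)} {n : ℕ} {F G : ℝ → ℂ}

theorem add (hF : IsReproducedBy φ n F) (hG : IsReproducedBy φ n G) :
    IsReproducedBy φ n (fun x => F x + G x) := fun x => by
  simp only [add_mul]
  refine ⟨(hF x).1.add (hG x).1, ?_⟩
  rw [integral_add (hF x).1 (hG x).1, (hF x).2, (hG x).2]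

theorem const_mul (hF : IsReproducedBy φ n F) (c : ℂ) :
    IsReproducedBy φ n (fun x => c * F x) := fun x => by
  simp only [mul_assoc]
  refine ⟨(hF x).1.const_mul c, ?_⟩
  rw [integral_const_mul, (hF x).2]

theorem finset_sum {ι : Type*} {s : Finset ι} {F : ι → ℝ → ℂ}
    (hF : ∀ i ∈ s, IsReproducedBy φ n (F i)) :
    IsReproducedBy φ n (fun x => ∑ i ∈ s, F i x) := fun x => by
  simp only [Finset.sum_mul]
  refine ⟨integrable_finsetSum _ fun i hi => (hF i hi x).1, ?_⟩
  rw [integral_finsetSum _ fun i hi => (hF i hi x).1]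
  exact Finset.sum_congr rfl fun i hi => (hF i hi x).2

theorem exp (hφ : ∀ s : ℝ, |s| ≤ 1 →
      ∫ u, Complex.exp (((s * u : ℝ) : ℂ) * Complex.I) * φ u = 1)
    {k : ℝ} (hk : |k| ≤ n) :
    IsReproducedBy φ n (fun x => Complex.exp (((k * x : ℝ) : ℂ) * Complex.I)) := fun x => by
  have hexp : ∀ u : ℝ, Complex.exp (((k * (x - u / n) : ℝ) : ℂ) * Complex.I) * φ u =
      Complex.exp (((k * x : ℝ) : ℂ) * Complex.I) *
        (Complex.exp (((-(k / n) * u : ℝ) : ℂ) * Complex.I) * φ u) := fun u => by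
    rw [← mul_assoc, ← Complex.exp_add, ← add_mul, ← Complex.ofReal_add]
    congr 4
    ring
  have hs : |(-(k / n))| ≤ 1 := by
    rw [abs_neg, abs_div, Nat.abs_cast]
    exact div_le_one_of_le₀ hk (Nat.cast_nonneg n)
  constructor
  · refine φ.integrable.bdd_mul (c := 1) (by fun_prop) (Filter.Eventually.of_forall fun u => ?_)
    rw [Complex.norm_exp_ofReal_mul_I]
  · simp only [hexp]
    rw [integral_const_mul, hφ _ hs, mul_one]

theorem of_isTrigPoly (hφ : ∀ s : ℝ, |s| ≤ 1 →
      ∫ u, Complex.exp (((s * u : ℝ) : ℂ) * Complex.I) * φ u = 1)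
    {p : ℝ → ℝ} (hp : IsTrigPoly n p) : IsReproducedBy φ n (fun x => (p x : ℂ)) := by
  obtain ⟨a, b, hp⟩ := hp
  have hconst : IsReproducedBy φ n (fun _ => (a 0 : ℂ)) := by
    simpa using (exp (n := n) hφ (k := 0) (by simp)).const_mul (a 0 : ℂ)
  have hterm : ∀ k ∈ Finset.Icc 1 n, IsReproducedBy φ n
      (fun x => ((a k * Real.cos (k * x) + b k * Real.sin (k * x) : ℝ) : ℂ)) := fun k hk => by
    have hkn : |(k : ℝ)| ≤ n := by
      rw [Nat.abs_cast]; exact_mod_cast (Finset.mem_Icc.1 hk).2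
    have h := ((exp hφ hkn).const_mul ((a k - b k * Complex.I) / 2)).add
      ((exp hφ (k := -(k : ℝ)) (by rwa [abs_neg])).const_mul ((a k + b k * Complex.I) / 2))
    convert h using 2 with x
    push_cast
    rw [neg_mul, Complex.cos, Complex.sin]
    ring
  convert hconst.add (finset_sum hterm) using 2 with x
  rw [hp]
  push_cast
  rfl

/-- Increments of a function reproduced by `φ` are controlled by increments of `φ`. -/
theorem sub_eq (hF : IsReproducedBy φ n F) (hn : n ≠ 0) (x d : ℝ) :
    F (x + d) - F x = ∫ v, F (x - v / n) * (φ (v + n * d) - φ v) := by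
  have hn' : (n : ℝ) ≠ 0 := Nat.cast_ne_zero.2 hn
  have hshift : ∀ v : ℝ, F (x + d - (v + n * d) / n) = F (x - v / n) := fun v => by
    congr 1
    field_simp
    ring
  have hint := (hF (x + d)).1.comp_add_right (n * d)
  have heq := integral_add_right_eq_self (μ := volume)
    (fun u => F (x + d - u / n) * φ u) (n * d)
  rw [(hF (x + d)).2] at heq
  simp only [hshift] at hint heq
  simp only [mul_sub]
  rw [integral_sub hint (hF x).1, heq, (hF x).2]

end IsReproducedBy

/-- A trigonometric polynomial of degree at most `n` oscillates slowly at scale `1 / n`. -/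
theorem IsTrigPoly.enorm_sub_le {φ : 𝓢(ℝ, ℂ)} {r : ℕ} {C : ℝ}
    (hφ : ∀ s : ℝ, |s| ≤ 1 → ∫ u, Complex.exp (((s * u : ℝ) : ℂ) * Complex.I) * φ u = 1)
    (hC : 0 ≤ C)
    (hφC : ∀ u v : ℝ, |v - u| ≤ 1 → ‖φ v - φ u‖ ≤ C * ((1 + |u|) ^ r)⁻¹ * |v - u|)
    {n : ℕ} (hn : n ≠ 0) {p : ℝ → ℝ} (hp : IsTrigPoly n p) {ε : ℝ} (hε : ε ≤ 1)
    (x d : ℝ) (hd : n * |d| ≤ ε) :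
    ‖p (x + d) - p x‖ₑ ≤ ENNReal.ofReal ε *
      ∫⁻ v, ENNReal.ofReal (C * ((1 + |v|) ^ r)⁻¹) * ‖p (x - v / n)‖ₑ := by
  have hsub := (IsReproducedBy.of_isTrigPoly hφ hp).sub_eq hn x d
  have hcast : ‖p (x + d) - p x‖ₑ = ‖(p (x + d) : ℂ) - p x‖ₑ := by
    rw [← Complex.ofReal_sub, enorm_eq_iff_norm_eq, Complex.norm_real]
  have hd0 : 0 ≤ ε := le_trans (by positivity) hd
  rw [hcast, hsub, ← lintegral_const_mul' _ _ ENNReal.ofReal_ne_top]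
  refine (enorm_integral_le_lintegral_enorm _).trans (lintegral_mono fun v => ?_)
  have habs : |v + n * d - v| = n * |d| := by
    rw [add_sub_cancel_left, abs_mul, Nat.abs_cast]
  have hφv : ‖φ (v + n * d) - φ v‖ₑ ≤ ENNReal.ofReal (ε * (C * ((1 + |v|) ^ r)⁻¹)) := by
    rw [← ofReal_norm]
    refine ENNReal.ofReal_le_ofReal ((hφC v (v + n * d) ?_).trans ?_)
    · rw [habs]; exact hd.trans hε
    · rw [habs, mul_comm]; gcongr
  have hpv : ‖(p (x - v / n) : ℂ)‖ₑ = ‖p (x - v / n)‖ₑ := by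
    rw [enorm_eq_iff_norm_eq, Complex.norm_real]
  rw [enorm_mul, hpv, ← mul_assoc, ← ENNReal.ofReal_mul hd0, mul_comm]
  gcongr

theorem Function.Periodic.setLIntegral_comp_add_right {F : ℝ → ℝ≥0∞} {T : ℝ}
    (hF : Function.Periodic F T) (hT : 0 < T) (a s : ℝ) :
    ∫⁻ x in Ioc a (a + T), F (x + s) = ∫⁻ x in Ioc a (a + T), F x := by
  have hmp := measurePreserving_add_right (volume : Measure ℝ) s
  have h1 := hmp.setLIntegral_comp_emb (measurableEmbedding_addRight s) F (Ioc a (a + T))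
  rw [image_add_const_Ioc, add_right_comm] at h1
  rw [h1]
  refine (isAddFundamentalDomain_Ioc hT (a + s)).setLIntegral_eq
    (isAddFundamentalDomain_Ioc hT a) F fun g x => ?_
  obtain ⟨g, k, rfl⟩ := g
  simpa [AddSubgroup.vadd_def, add_comm] using hF.zsmul k x

/-- The mass that the density `w` gives to the window of radius `δ` around `x`. -/
def windowMass (w : ℝ → ℝ≥0∞) (δ x : ℝ) : ℝ≥0∞ :=
  ∫⁻ s in Ioc (-δ) δ, w (x + s)

section windowMass

variable {w : ℝ → ℝ≥0∞} {δ x : ℝ}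

theorem windowMass_eq (w : ℝ → ℝ≥0∞) (δ x : ℝ) :
    windowMass w δ x = ∫⁻ t in Ioc (x - δ) (x + δ), w t := by
  have h := (measurePreserving_add_left (volume : Measure ℝ) x).setLIntegral_comp_emb
    (measurableEmbedding_addLeft x) w (Ioc (-δ) δ)
  rw [image_const_add_Ioc] at h
  exact h

theorem measurable_windowMass (hw : Measurable w) (δ : ℝ) : Measurable (windowMass w δ) := by
  unfold windowMass
  exact Measurable.lintegral_prod_right' (f := fun z : ℝ × ℝ => w (z.1 + z.2))
    (hw.comp (measurable_fst.add measurable_snd))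

theorem windowMass_periodic {T : ℝ} (hw : Function.Periodic w T) (δ : ℝ) :
    Function.Periodic (windowMass w δ) T := fun x => by
  unfold windowMass
  simp only [add_right_comm x T, hw _]

theorem setLIntegral_windowMass {T : ℝ} (hT : 0 < T) (hw : Measurable w)
    (hper : Function.Periodic w T) (a δ : ℝ) :
    ∫⁻ x in Ioc a (a + T), windowMass w δ x =
      ENNReal.ofReal (2 * δ) * ∫⁻ x in Ioc a (a + T), w x := by
  unfold windowMass
  rw [lintegral_lintegral_swap (by fun_prop)]
  simp only [hper.setLIntegral_comp_add_right hT]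
  rw [setLIntegral_const, Real.volume_Ioc, mul_comm]
  congr 2
  ring

theorem windowMass_two_pow_mul_le {Λ : ℝ≥0∞}
    (hdbl : ∀ δ, 0 < δ → ∀ a, windowMass w (2 * δ) a ≤ Λ * windowMass w δ a)
    (hδ : 0 < δ) (m : ℕ) (x : ℝ) :
    windowMass w (2 ^ m * δ) x ≤ Λ ^ m * windowMass w δ x := by
  induction m with
  | zero => simp
  | succ m ih =>
    calc windowMass w (2 ^ (m + 1) * δ) x = windowMass w (2 * (2 ^ m * δ)) x := by
          rw [pow_succ', mul_assoc]
      _ ≤ Λ * windowMass w (2 ^ m * δ) x := hdbl _ (by positivity) _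
      _ ≤ Λ * (Λ ^ m * windowMass w δ x) := by gcongr
      _ = Λ ^ (m + 1) * windowMass w δ x := by rw [pow_succ', mul_assoc]

/-- The window masses of a doubling weight grow at most polynomially under translation. -/
theorem windowMass_le_mul_windowMass_sub {q : ℕ}
    (hdbl : ∀ δ, 0 < δ → ∀ a, windowMass w (2 * δ) a ≤ 2 ^ q * windowMass w δ a)
    (hδ : 0 < δ) (x v : ℝ) :
    windowMass w δ x ≤
      ENNReal.ofReal ((2 * (1 + |v|)) ^ q) * windowMass w δ (x - v * δ) := by
  obtain ⟨m, hm1, hm2⟩ := exists_nat_pow_near (x := 1 + |v|) (y := 2)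
    (by linarith [abs_nonneg v]) one_lt_two
  have hsub : Ioc (x - δ) (x + δ) ⊆
      Ioc (x - v * δ - 2 ^ (m + 1) * δ) (x - v * δ + 2 ^ (m + 1) * δ) := by
    apply Ioc_subset_Ioc
    · nlinarith [neg_abs_le v]
    · nlinarith [le_abs_self v]
  calc windowMass w δ x ≤ windowMass w (2 ^ (m + 1) * δ) (x - v * δ) := by
        rw [windowMass_eq, windowMass_eq]
        exact lintegral_mono_set hsub
    _ ≤ (2 ^ q) ^ (m + 1) * windowMass w δ (x - v * δ) :=
        windowMass_two_pow_mul_le hdbl hδ _ _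
    _ ≤ _ := by
        gcongr
        rw [← pow_mul, mul_comm q, pow_mul, ENNReal.ofReal_pow (by positivity)]
        gcongr
        rw [pow_succ', ENNReal.ofReal_mul zero_le_two, ENNReal.ofReal_ofNat,
          ← ENNReal.ofReal_ofNat 2, ← ENNReal.ofReal_pow zero_le_two]
        gcongr

end windowMass

/-- The part of the main estimate that takes place in a single window. -/
theorem mul_windowMass_le {w P : ℝ → ℝ≥0∞} (hw : Measurable w) {Λ : ℝ≥0∞}
    (hdbl : ∀ δ, 0 < δ → ∀ a, windowMass w (2 * δ) a ≤ Λ * windowMass w δ a)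
    {δ x : ℝ} (hfin : ∀ δ, windowMass w δ x ≠ ∞) (hδ : 0 < δ) {e : ℝ≥0∞} {m : ℕ}
    (hP : ∀ d, |d| ≤ δ / 2 ^ m → P x ≤ P (x + d) + e) :
    P x * windowMass w δ x ≤
      Λ ^ m * windowMass (fun t => P t * w t) (δ / 2 ^ m) x + e * windowMass w δ x := by
  set h := δ / 2 ^ m with hh
  have hδh : windowMass w δ x ≤ Λ ^ m * windowMass w h x := by
    have := windowMass_two_pow_mul_le hdbl (δ := h) (by positivity) m x
    rwa [hh, mul_div_cancel₀ _ (by positivity)] at this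
  have hwx : Measurable fun s => w (x + s) := hw.comp (measurable_const_add x)
  have hsmall : P x * windowMass w h x ≤
      windowMass (fun t => P t * w t) h x + e * windowMass w h x := by
    unfold windowMass
    rw [← lintegral_const_mul _ hwx, ← lintegral_const_mul _ hwx,
      ← lintegral_add_right _ (hwx.const_mul e)]
    refine setLIntegral_mono' measurableSet_Ioc fun s hs => ?_
    rw [← add_mul]
    gcongr
    exact hP s (abs_le.2 ⟨hs.1.le, hs.2⟩)
  rcases eq_or_ne (windowMass w h x) 0 with h0 | h0
  · have : windowMass w δ x = 0 := by simpa [h0] using hδh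
    simp [this]
  have hr : windowMass w δ x = windowMass w δ x / windowMass w h x * windowMass w h x :=
    (ENNReal.div_mul_cancel h0 (hfin h)).symm
  have hrΛ : windowMass w δ x / windowMass w h x ≤ Λ ^ m := ENNReal.div_le_of_le_mul hδh
  set ρ := windowMass w δ x / windowMass w h x
  calc P x * windowMass w δ x = ρ * (P x * windowMass w h x) := by rw [hr]; ring
    _ ≤ ρ * (windowMass (fun t => P t * w t) h x + e * windowMass w h x) := by gcongr
    _ = ρ * windowMass (fun t => P t * w t) h x + e * windowMass w δ x := by
        rw [hr]; ring
    _ ≤ _ := by gcongr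

/-- Convolving with a rapidly decaying kernel is bounded with respect to the window masses of a
doubling weight. -/
theorem setLIntegral_convolution_mul_windowMass_le {w P g : ℝ → ℝ≥0∞} {T : ℝ} (hT : 0 < T)
    (hw : Measurable w) (hP : Measurable P) (hg : Measurable g)
    (hwT : Function.Periodic w T) (hPT : Function.Periodic P T) {q : ℕ}
    (hdbl : ∀ δ, 0 < δ → ∀ a, windowMass w (2 * δ) a ≤ 2 ^ q * windowMass w δ a)
    {δ : ℝ} (hδ : 0 < δ) (a : ℝ) :
    ∫⁻ x in Ioc a (a + T), (∫⁻ v, g v * P (x - v * δ)) * windowMass w δ x ≤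
      (∫⁻ v, g v * ENNReal.ofReal ((2 * (1 + |v|)) ^ q)) *
        ∫⁻ x in Ioc a (a + T), P x * windowMass w δ x := by
  have hA := measurable_windowMass hw δ
  have hm2 : Measurable fun z : ℝ × ℝ => g z.2 * P (z.1 - z.2 * δ) :=
    (hg.comp measurable_snd).mul (hP.comp (by fun_prop))
  have hPA : Function.Periodic (fun x => P x * windowMass w δ x) T :=
    hPT.mul (windowMass_periodic hwT δ)
  calc ∫⁻ x in Ioc a (a + T), (∫⁻ v, g v * P (x - v * δ)) * windowMass w δ x
      = ∫⁻ x in Ioc a (a + T), ∫⁻ v, g v * P (x - v * δ) * windowMass w δ x := by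
        refine lintegral_congr fun x => ?_
        rw [lintegral_mul_const _ (by fun_prop)]
    _ = ∫⁻ v, ∫⁻ x in Ioc a (a + T), g v * P (x - v * δ) * windowMass w δ x :=
        lintegral_lintegral_swap (hm2.mul (hA.comp measurable_fst)).aemeasurable
    _ ≤ ∫⁻ v, g v * ENNReal.ofReal ((2 * (1 + |v|)) ^ q) *
          ∫⁻ x in Ioc a (a + T), P x * windowMass w δ x := by
        refine lintegral_mono fun v => ?_
        rw [← hPA.setLIntegral_comp_add_right hT a (-(v * δ)),
          ← lintegral_const_mul _ (by fun_prop)]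
        refine lintegral_mono fun x => ?_
        calc g v * P (x - v * δ) * windowMass w δ x
            ≤ g v * P (x - v * δ) * (ENNReal.ofReal ((2 * (1 + |v|)) ^ q) *
                windowMass w δ (x - v * δ)) := by
              gcongr
              exact windowMass_le_mul_windowMass_sub hdbl hδ x v
          _ = _ := by simp only [← sub_eq_add_neg]; ring
    _ = _ := lintegral_mul_const _ (hg.mul (by fun_prop))

/-- Mastroianni–Totik inequality for a function `P` that oscillates slowly at scale `δ`. -/
theorem setLIntegral_mul_windowMass_le {w P g : ℝ → ℝ≥0∞} {T : ℝ} (hT : 0 < T)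
    (hw : Measurable w) (hP : Measurable P) (hg : Measurable g)
    (hwT : Function.Periodic w T) (hPT : Function.Periodic P T) {q : ℕ} {Λ : ℝ≥0∞}
    (hΛ : Λ ≤ 2 ^ q)
    (hdbl : ∀ δ, 0 < δ → ∀ a, windowMass w (2 * δ) a ≤ Λ * windowMass w δ a)
    (hfin : ∀ δ x, windowMass w δ x ≠ ∞) {δ : ℝ} (hδ : 0 < δ) {a : ℝ}
    (hPfin : ∫⁻ x in Ioc a (a + T), P x * windowMass w δ x ≠ ∞) {ε : ℝ≥0∞} {m : ℕ}
    (hPg : ∀ x d, |d| ≤ δ / 2 ^ m → P x ≤ P (x + d) + ε * ∫⁻ v, g v * P (x - v * δ))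
    (hε : ε * ∫⁻ v, g v * ENNReal.ofReal ((2 * (1 + |v|)) ^ q) ≤ 2⁻¹) :
    ∫⁻ x in Ioc a (a + T), P x * windowMass w δ x ≤
      ENNReal.ofReal (4 * δ) * Λ ^ m * ∫⁻ x in Ioc a (a + T), P x * w x := by
  set I := ∫⁻ x in Ioc a (a + T), P x * windowMass w δ x
  set J := ∫⁻ x in Ioc a (a + T), P x * w x
  have hPw : Measurable fun t => P t * w t := hP.mul hw
  have hPwA := measurable_windowMass hPw (δ / 2 ^ m)
  have hmain : I ≤ Λ ^ m * (ENNReal.ofReal (2 * δ) * J) + 2⁻¹ * I := by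
    calc I ≤ ∫⁻ x in Ioc a (a + T), (Λ ^ m * windowMass (fun t => P t * w t) (δ / 2 ^ m) x +
            ε * (∫⁻ v, g v * P (x - v * δ)) * windowMass w δ x) :=
          lintegral_mono fun x => mul_windowMass_le hw hdbl (fun δ => hfin δ x) hδ (hPg x)
      _ = Λ ^ m * (ENNReal.ofReal (2 * (δ / 2 ^ m)) * J) +
            ε * ∫⁻ x in Ioc a (a + T), (∫⁻ v, g v * P (x - v * δ)) * windowMass w δ x := by
          have hconv : Measurable fun x => ∫⁻ v, g v * P (x - v * δ) :=
            Measurable.lintegral_prod_right' (f := fun z : ℝ × ℝ => g z.2 * P (z.1 - z.2 * δ))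
              ((hg.comp measurable_snd).mul (hP.comp (by fun_prop)))
          simp only [mul_assoc ε]
          have hA := measurable_windowMass hw δ
          rw [lintegral_add_left (hPwA.const_mul _), lintegral_const_mul _ hPwA,
            lintegral_const_mul _ (by fun_prop),
            setLIntegral_windowMass hT hPw (hPT.mul hwT)]
      _ ≤ Λ ^ m * (ENNReal.ofReal (2 * δ) * J) + ε *
            ((∫⁻ v, g v * ENNReal.ofReal ((2 * (1 + |v|)) ^ q)) * I) := by
          gcongr
          · exact div_le_self hδ.le (one_le_pow₀ one_le_two)
          · refine setLIntegral_convolution_mul_windowMass_le hT hw hP hg hwT hPT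
              (fun δ hδ a => (hdbl δ hδ a).trans ?_) hδ a
            gcongr
      _ ≤ _ := by rw [← mul_assoc ε]; gcongr
  have hhalf : 2⁻¹ * I ≠ ∞ := ENNReal.mul_ne_top (by simp) hPfin
  have hsplit : 2⁻¹ * I + 2⁻¹ * I = I := by
    rw [← add_mul, ENNReal.inv_two_add_inv_two, one_mul]
  have hle : 2⁻¹ * I ≤ Λ ^ m * (ENNReal.ofReal (2 * δ) * J) := by
    refine (ENNReal.add_le_add_iff_right hhalf).1 ?_
    rwa [hsplit]
  calc I = 2⁻¹ * I + 2⁻¹ * I := hsplit.symm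
    _ ≤ Λ ^ m * (ENNReal.ofReal (2 * δ) * J) + Λ ^ m * (ENNReal.ofReal (2 * δ) * J) := by gcongr
    _ = ENNReal.ofReal (4 * δ) * Λ ^ m * J := by
        have : ENNReal.ofReal (4 * δ) = ENNReal.ofReal (2 * δ) + ENNReal.ofReal (2 * δ) := by
          rw [← ENNReal.ofReal_add (by positivity) (by positivity)]
          congr 1; ring
        rw [this]; ring

theorem integral_le_of_lintegral_ofReal_le {α : Type*} [MeasurableSpace α] {μ : Measure α}
    {f : α → ℝ} {c : ℝ} (hc : 0 ≤ c)
    (h : ∫⁻ x, ENNReal.ofReal (f x) ∂μ ≤ ENNReal.ofReal c) : ∫ x, f x ∂μ ≤ c := by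
  by_cases hf : Integrable f μ
  · rw [integral_eq_lintegral_pos_part_sub_lintegral_neg_part hf]
    exact (sub_le_self _ ENNReal.toReal_nonneg).trans (ENNReal.toReal_le_of_le_ofReal hc h)
  · rwa [integral_undef hf]

section Weight

variable {W : ℝ → ℝ}

theorem IsPeriodicWeight.intervalIntegrable (hW : IsPeriodicWeight W) (a b : ℝ) :
    IntervalIntegrable W volume a b := by
  refine hW.2.2.1.intervalIntegrable two_pi_pos.ne' (t := -π) ?_ a b
  convert hW.2.2.2.1 using 1
  ring

theorem IsPeriodicWeight.windowMass_eq_ofReal (hW : IsPeriodicWeight W) {δ : ℝ} (hδ : 0 ≤ δ)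
    (x : ℝ) : windowMass (fun t => ENNReal.ofReal (W t)) δ x =
      ENNReal.ofReal (∫ t in (x - δ)..(x + δ), W t) := by
  have hle : x - δ ≤ x + δ := by linarith
  rw [windowMass_eq, intervalIntegral.integral_of_le hle, ofReal_integral_eq_lintegral_ofReal
    ((intervalIntegrable_iff_integrableOn_Ioc_of_le hle).1 (hW.intervalIntegrable _ _))
    (Filter.Eventually.of_forall hW.2.1)]

theorem IsPeriodicWeight.windowMass_ne_top (hW : IsPeriodicWeight W) (δ x : ℝ) :
    windowMass (fun t => ENNReal.ofReal (W t)) δ x ≠ ∞ := by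
  rcases le_total 0 δ with hδ | hδ
  · rw [hW.windowMass_eq_ofReal hδ]
    exact ENNReal.ofReal_ne_top
  · rw [windowMass, Ioc_eq_empty (by linarith)]
    simp

theorem IsDoublingPeriodic.windowMass_le {L : ℝ} (hL : 0 ≤ L) (hW : IsPeriodicWeight W)
    (hWL : IsDoublingPeriodic W L) (δ : ℝ) (hδ : 0 < δ) (a : ℝ) :
    windowMass (fun t => ENNReal.ofReal (W t)) (2 * δ) a ≤
      ENNReal.ofReal L * windowMass (fun t => ENNReal.ofReal (W t)) δ a := by
  rw [hW.windowMass_eq_ofReal (by positivity), hW.windowMass_eq_ofReal hδ.le,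
    ← ENNReal.ofReal_mul hL]
  exact ENNReal.ofReal_le_ofReal (hWL δ hδ a)

end Weight

theorem lintegral_inv_one_add_pow_mul_ne_top (C : ℝ) (hC : 0 ≤ C) (q : ℕ) :
    ∫⁻ v : ℝ, ENNReal.ofReal (C * ((1 + |v|) ^ (q + 2))⁻¹) *
      ENNReal.ofReal ((2 * (1 + |v|)) ^ q) ≠ ∞ := by
  have hfin := finite_integral_one_add_norm (E := ℝ) (μ := volume) (r := 2) (by simp)
  have heq : ∀ v : ℝ, ENNReal.ofReal (C * ((1 + |v|) ^ (q + 2))⁻¹) *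
      ENNReal.ofReal ((2 * (1 + |v|)) ^ q) =
      ENNReal.ofReal (C * 2 ^ q) * ENNReal.ofReal ((1 + ‖v‖) ^ (-2 : ℝ)) := fun v => by
    rw [← ENNReal.ofReal_mul (by positivity), ← ENNReal.ofReal_mul (by positivity)]
    congr 1
    rw [Real.rpow_neg (by positivity), Real.rpow_two, Real.norm_eq_abs]
    field_simp
    rw [mul_pow]
    ring
  simp only [heq]
  rw [lintegral_const_mul' _ _ ENNReal.ofReal_ne_top]
  exact ENNReal.mul_ne_top ENNReal.ofReal_ne_top hfin.ne

theorem IsTrigPoly.exists_enorm_le {n : ℕ} {p : ℝ → ℝ} (hp : IsTrigPoly n p) :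
    ∃ B : ℝ≥0∞, B ≠ ∞ ∧ ∀ x, ‖p x‖ₑ ≤ B := by
  obtain ⟨B, hB⟩ := isBounded_iff_forall_norm_le.1
    (hp.periodic.isBounded_of_continuous two_pi_pos.ne' hp.continuous)
  refine ⟨ENNReal.ofReal B, ENNReal.ofReal_ne_top, fun x => ?_⟩
  rw [← ofReal_norm]
  exact ENNReal.ofReal_le_ofReal (hB _ (mem_range_self x))

/-- The Mastroianni–Totik inequality for lower Lebesgue integrals. -/
theorem exists_setLIntegral_mul_windowMass_le (L : ℝ) (hL : 0 ≤ L) :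
    ∃ m : ℕ, ∀ W : ℝ → ℝ, IsPeriodicWeight W → IsDoublingPeriodic W L →
      ∀ n : ℕ, 1 ≤ n → ∀ p : ℝ → ℝ, IsTrigPoly n p →
        ∫⁻ x in Ioc (-π) π, ‖p x‖ₑ * windowMass (fun t => ENNReal.ofReal (W t)) (1 / n) x ≤
          ENNReal.ofReal (4 * (1 / n)) * ENNReal.ofReal L ^ m *
            ∫⁻ x in Ioc (-π) π, ‖p x‖ₑ * ENNReal.ofReal (W x) := by
  obtain ⟨q, hq⟩ := pow_unbounded_of_one_lt L one_lt_two
  obtain ⟨φ, hφ⟩ := exists_schwartzMap_integral_exp_mul_eq_one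
  obtain ⟨C, hC, hφC⟩ := φ.exists_norm_sub_le_mul_inv_one_add_pow (q + 2)
  have hK := lintegral_inv_one_add_pow_mul_ne_top C hC q
  set K := ∫⁻ v : ℝ, ENNReal.ofReal (C * ((1 + |v|) ^ (q + 2))⁻¹) *
      ENNReal.ofReal ((2 * (1 + |v|)) ^ q)
  obtain ⟨m, hm⟩ := pow_unbounded_of_one_lt (2 * K.toReal) one_lt_two
  have hεK : ENNReal.ofReal (1 / 2 ^ m) * K ≤ 2⁻¹ := by
    rw [← ENNReal.ofReal_toReal hK, ← ENNReal.ofReal_mul (by positivity),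
      ← ENNReal.ofReal_ofNat 2, ← ENNReal.ofReal_inv_of_pos two_pos]
    refine ENNReal.ofReal_le_ofReal ?_
    rw [one_div_mul_eq_div, div_le_iff₀ (by positivity)]
    linarith
  refine ⟨m, fun W hW hWL n hn p hp => ?_⟩
  have hn0 : n ≠ 0 := by omega
  have hn' : (0 : ℝ) < n := by positivity
  have hwm : Measurable fun t => ENNReal.ofReal (W t) := hW.1.ennreal_ofReal
  have hwT : Function.Periodic (fun t => ENNReal.ofReal (W t)) (2 * π) :=
    hW.2.2.1.comp ENNReal.ofReal
  have hpi : -π + 2 * π = π := by ring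
  have hfin : ∫⁻ x in Ioc (-π) (-π + 2 * π),
      ‖p x‖ₑ * windowMass (fun t => ENNReal.ofReal (W t)) (1 / n) x ≠ ∞ := by
    obtain ⟨B, hB, hpB⟩ := hp.exists_enorm_le
    have hWfin : ∫⁻ x in Ioc (-π) (-π + 2 * π), ENNReal.ofReal (W x) ≠ ∞ := by
      have := hW.windowMass_ne_top π 0
      rw [hpi]
      rwa [windowMass_eq, zero_sub, zero_add] at this
    refine ne_top_of_le_ne_top ?_ (lintegral_mono fun x => mul_le_mul_left (hpB x) _)
    rw [lintegral_const_mul' _ _ hB, setLIntegral_windowMass two_pi_pos hwm hwT]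
    exact ENNReal.mul_ne_top hB (ENNReal.mul_ne_top ENNReal.ofReal_ne_top hWfin)
  have key := setLIntegral_mul_windowMass_le (q := q) (Λ := ENNReal.ofReal L) (δ := 1 / n)
    (a := -π) (m := m) (P := fun x => ‖p x‖ₑ)
    (g := fun v => ENNReal.ofReal (C * ((1 + |v|) ^ (q + 2))⁻¹))
    two_pi_pos hwm hp.continuous.enorm.measurable (by fun_prop) hwT (hp.periodic.comp _) ?_
    (hWL.windowMass_le hL hW) hW.windowMass_ne_top (by positivity) hfin (fun x d hd => ?_) hεK
  · rwa [hpi] at key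
  · rw [← ENNReal.ofReal_ofNat 2, ← ENNReal.ofReal_pow zero_le_two]
    exact ENNReal.ofReal_le_ofReal hq.le
  · have hnd : n * |d| ≤ 1 / 2 ^ m := by
      calc n * |d| ≤ n * (1 / n / 2 ^ m) := by gcongr
        _ = 1 / 2 ^ m := by field_simp
    have hsub := hp.enorm_sub_le hφ hC hφC hn0
      (div_le_one_of_le₀ (one_le_pow₀ one_le_two) (by positivity)) x d hnd
    calc ‖p x‖ₑ = ‖p (x + d) - (p (x + d) - p x)‖ₑ := by rw [sub_sub_cancel]
      _ ≤ ‖p (x + d)‖ₑ + ‖p (x + d) - p x‖ₑ := enorm_sub_le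
      _ ≤ _ := by
        simp only [mul_one_div]
        gcongr

/-- Mastroianni–Totik: integrating `|p|` against the averaged weight `W_n` is dominated,
up to a constant depending only on the doubling constant, by integrating against `W`. -/
theorem mastroianni_totik (L : ℝ) (hL : 2 ≤ L) :
    ∃ C > (0:ℝ),
      ∀ W : ℝ → ℝ, IsPeriodicWeight W → IsDoublingPeriodic W L →
        ∀ n : ℕ, 1 ≤ n → ∀ p : ℝ → ℝ, IsTrigPoly n p →
          (∫ θ in (-π)..π, |p θ| * (n * ∫ t in (θ - 1/n)..(θ + 1/n), W t)) ≤
            C * ∫ θ in (-π)..π, |p θ| * W θ := by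
  have hL0 : 0 < L := by linarith
  obtain ⟨m, hm⟩ := exists_setLIntegral_mul_windowMass_le L hL0.le
  refine ⟨4 * L ^ m, by positivity, fun W hW hWL n hn p hp => ?_⟩
  have hn' : (0 : ℝ) < n := by exact_mod_cast hn
  have hpi : -π ≤ π := by linarith [pi_pos]
  have hwin : ∀ θ : ℝ, 0 ≤ ∫ t in (θ - 1 / n)..(θ + 1 / n), W t := fun θ =>
    intervalIntegral.integral_nonneg_of_forall (by linarith [one_div_pos.2 hn']) hW.2.1
  have hLHS : ∀ θ, ENNReal.ofReal (|p θ| * (n * ∫ t in (θ - 1/n)..(θ + 1/n), W t)) =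
      ENNReal.ofReal n * (‖p θ‖ₑ * windowMass (fun t => ENNReal.ofReal (W t)) (1 / n) θ) :=
    fun θ => by
      rw [hW.windowMass_eq_ofReal (by positivity), ← ofReal_norm, Real.norm_eq_abs,
        ← ENNReal.ofReal_mul (abs_nonneg _), ← ENNReal.ofReal_mul hn'.le, mul_left_comm]
  have hRHS : ∀ θ, ENNReal.ofReal (|p θ| * W θ) = ‖p θ‖ₑ * ENNReal.ofReal (W θ) := fun θ => by
    rw [← ofReal_norm, Real.norm_eq_abs, ← ENNReal.ofReal_mul (abs_nonneg _)]
  have hint : IntegrableOn (fun θ => |p θ| * W θ) (Ioc (-π) π) :=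
    (intervalIntegrable_iff_integrableOn_Ioc_of_le hpi).1
      ((hW.intervalIntegrable _ _).continuousOn_mul hp.continuous.abs.continuousOn)
  have hR0 : 0 ≤ ∫ θ in Ioc (-π) π, |p θ| * W θ :=
    integral_nonneg fun θ => mul_nonneg (abs_nonneg _) (hW.2.1 θ)
  rw [intervalIntegral.integral_of_le hpi, intervalIntegral.integral_of_le hpi]
  refine integral_le_of_lintegral_ofReal_le (by positivity) ?_
  simp only [hLHS]
  rw [lintegral_const_mul' _ _ ENNReal.ofReal_ne_top, ENNReal.ofReal_mul (by positivity),
    ofReal_integral_eq_lintegral_ofReal hint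
      (Filter.Eventually.of_forall fun θ => mul_nonneg (abs_nonneg _) (hW.2.1 θ))]
  simp only [hRHS]
  calc _ ≤ ENNReal.ofReal n * (ENNReal.ofReal (4 * (1 / n)) * ENNReal.ofReal L ^ m *
            ∫⁻ x in Ioc (-π) π, ‖p x‖ₑ * ENNReal.ofReal (W x)) := by
        gcongr
        exact hm W hW hWL n hn p hp
    _ = _ := by
        rw [← mul_assoc, ← ENNReal.ofReal_pow hL0.le, ← ENNReal.ofReal_mul (by positivity),
          ← ENNReal.ofReal_mul hn'.le]
        congr 2
        field_simp
end
end

section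
/- For every L ≥ 2 there exists a positive constant C(L), depending only on L, such that the following holds: if w is a doubling weight function on [-1,1] with doubling constant L, and W is the 2π-periodic function defined by W(θ) := w(cos θ)|sin θ|, then W is a 2π-periodic weight function which is doubling with doubling constant C(L). -/
open MeasureTheory Real Set

noncomputable section

/-- A weight function on `[-1,1]`: nonnegative, zero outside `[-1,1]`, integrable,
with positive integral. -/
def IsWeight (w : ℝ → ℝ) : Prop :=
  Measurable w ∧ (∀ t, 0 ≤ w t) ∧ (∀ t, t ∉ Icc (-1:ℝ) 1 → w t = 0) ∧
  IntervalIntegrable w volume (-1) 1 ∧ 0 < ∫ t in (-1:ℝ)..1, w t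

/-- `w` is doubling with doubling constant `L`. -/
def IsDoubling (w : ℝ → ℝ) (L : ℝ) : Prop :=
  ∀ δ : ℝ, 0 < δ → ∀ a ∈ Icc (-1:ℝ) 1,
    (∫ t in (a - 2*δ)..(a + 2*δ), w t) ≤ L * ∫ t in (a - δ)..(a + δ), w t

theorem IsWeight.integrable {w : ℝ → ℝ} (hw : IsWeight w) : Integrable w := by
  obtain ⟨-, -, hsupp, hint, -⟩ := hw
  rw [intervalIntegrable_iff_integrableOn_Icc_of_le (by norm_num)] at hint
  refine (integrableOn_iff_integrable_of_support_subset fun t ht => ?_).1 hint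
  by_contra h
  exact ht (hsupp t h)

theorem IsWeight.comp_neg {w : ℝ → ℝ} (hw : IsWeight w) : IsWeight (fun t => w (-t)) := by
  refine ⟨hw.1.comp measurable_neg, fun t => hw.2.1 _, fun t ht => hw.2.2.1 _ fun h => ht ?_,
    hw.integrable.comp_neg.intervalIntegrable, ?_⟩
  · exact ⟨by linarith [h.2], by linarith [h.1]⟩
  · rw [intervalIntegral.integral_comp_neg]
    simpa using hw.2.2.2.2

theorem IsDoubling.comp_neg {w : ℝ → ℝ} {L : ℝ} (h : IsDoubling w L) :
    IsDoubling (fun t => w (-t)) L := by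
  intro δ hδ a ha
  have := h δ hδ (-a) ⟨by linarith [ha.2], by linarith [ha.1]⟩
  rw [intervalIntegral.integral_comp_neg, intervalIntegral.integral_comp_neg]
  convert this using 3 <;> ring

theorem IsDoubling.integral_le_pow {w : ℝ → ℝ} {L : ℝ} (h : IsDoubling w L) (hL : 0 ≤ L)
    {x : ℝ} (hx : x ∈ Icc (-1 : ℝ) 1) {r : ℝ} (hr : 0 < r) (k : ℕ) :
    (∫ t in (x - 2 ^ k * r)..(x + 2 ^ k * r), w t) ≤ L ^ k * ∫ t in (x - r)..(x + r), w t := by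
  induction k with
  | zero => simp
  | succ k ih =>
    have h1 := h (2 ^ k * r) (by positivity) x hx
    rw [← mul_assoc, ← pow_succ'] at h1
    calc _ ≤ _ := h1
      _ ≤ _ := mul_le_mul_of_nonneg_left ih hL
      _ = _ := by ring

theorem IsWeight.integral_mono {w : ℝ → ℝ} (hw : IsWeight w) {a b c d : ℝ} (hca : c ≤ a)
    (hab : a ≤ b) (hbd : b ≤ d) : (∫ t in a..b, w t) ≤ ∫ t in c..d, w t :=
  intervalIntegral.integral_mono_interval hca hab hbd (ae_of_all _ hw.2.1)
    hw.integrable.intervalIntegrable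

/-- The function `θ ↦ w (cos θ) |sin θ|`. -/
def cosPullback (w : ℝ → ℝ) : ℝ → ℝ := fun θ => w (Real.cos θ) * |Real.sin θ|

theorem cosPullback_nonneg {w : ℝ → ℝ} (hw : IsWeight w) (θ : ℝ) : 0 ≤ cosPullback w θ :=
  mul_nonneg (hw.2.1 _) (abs_nonneg _)

theorem cosPullback_neg (w : ℝ → ℝ) (θ : ℝ) : cosPullback w (-θ) = cosPullback w θ := by
  simp [cosPullback]

theorem cosPullback_periodic (w : ℝ → ℝ) : Function.Periodic (cosPullback w) (2 * π) := by
  intro θ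
  simp [cosPullback]

theorem integral_cosPullback_neg (w : ℝ → ℝ) (a b : ℝ) :
    (∫ θ in (-b)..(-a), cosPullback w θ) = ∫ θ in a..b, cosPullback w θ := by
  rw [← intervalIntegral.integral_comp_neg]
  simp only [cosPullback_neg]

theorem sin_nonneg_of_mem_uIoo {α β θ : ℝ} (hα : α ∈ Icc 0 π) (hβ : β ∈ Icc 0 π)
    (hθ : θ ∈ Ioo (min α β) (max α β)) : 0 ≤ Real.sin θ :=
  sin_nonneg_of_nonneg_of_le_pi ((le_min hα.1 hβ.1).trans hθ.1.le)
    (hθ.2.le.trans (max_le hα.2 hβ.2))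

theorem cosPullback_eqOn (w : ℝ → ℝ) {α β : ℝ} (hα : α ∈ Icc 0 π) (hβ : β ∈ Icc 0 π) :
    EqOn (cosPullback w) (fun θ => -((w ∘ Real.cos) θ * -Real.sin θ)) (uIcc α β) := by
  intro θ hθ
  have h : θ ∈ Icc 0 π := uIcc_subset_Icc hα hβ hθ
  simp [cosPullback, abs_of_nonneg (sin_nonneg_of_mem_Icc h)]

theorem integral_cosPullback (w : ℝ → ℝ) {α β : ℝ} (hα : α ∈ Icc 0 π) (hβ : β ∈ Icc 0 π) :
    (∫ θ in α..β, cosPullback w θ) = ∫ t in (Real.cos β)..(Real.cos α), w t := by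
  rw [intervalIntegral.integral_congr (cosPullback_eqOn w hα hβ),
    intervalIntegral.integral_neg,
    intervalIntegral.integral_comp_mul_deriv_of_deriv_nonpos continuous_cos.continuousOn
      (fun θ _ => hasDerivAt_cos θ)
      (fun θ hθ => neg_nonpos.2 (sin_nonneg_of_mem_uIoo hα hβ hθ)),
    ← intervalIntegral.integral_symm]

theorem intervalIntegrable_cosPullback {w : ℝ → ℝ} (hw : IsWeight w) (a b : ℝ) :
    IntervalIntegrable (cosPullback w) volume a b := by
  have h0 : (0 : ℝ) ∈ Icc 0 π := ⟨le_rfl, pi_pos.le⟩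
  have hpi : π ∈ Icc 0 π := ⟨pi_pos.le, le_rfl⟩
  have h1 : IntervalIntegrable (cosPullback w) volume 0 π := by
    have := (intervalIntegral.integrable_comp_mul_deriv_iff_of_deriv_nonpos (a := 0) (b := π)
      (g := w) continuous_cos.continuousOn (fun θ _ => hasDerivAt_cos θ)
      (fun θ hθ => neg_nonpos.2 (sin_nonneg_of_mem_uIoo h0 hpi hθ))).2
        hw.integrable.intervalIntegrable
    exact this.neg.congr fun θ hθ => (cosPullback_eqOn w h0 hpi (uIoc_subset_uIcc hθ)).symm
  have h2 : IntervalIntegrable (cosPullback w) volume (-π) 0 := by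
    have := ((IntervalIntegrable.iff_comp_neg (by simp)).1 h1).symm
    simpa [cosPullback_neg] using this
  refine (cosPullback_periodic w).intervalIntegrable (t := -π) two_pi_pos.ne' ?_ a b
  rw [show -π + 2 * π = π by ring]
  exact h2.trans h1

theorem integral_cosPullback_mono {w : ℝ → ℝ} (hw : IsWeight w) {a b c d : ℝ} (hca : c ≤ a)
    (hab : a ≤ b) (hbd : b ≤ d) :
    (∫ θ in a..b, cosPullback w θ) ≤ ∫ θ in c..d, cosPullback w θ :=
  intervalIntegral.integral_mono_interval hca hab hbd (ae_of_all _ (cosPullback_nonneg hw))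
    (intervalIntegrable_cosPullback hw c d)

theorem integral_cosPullback_period {w : ℝ → ℝ} (hw : IsWeight w) (a : ℝ) :
    (∫ θ in a..(a + 2 * π), cosPullback w θ) = 2 * ∫ t in (-1 : ℝ)..1, w t := by
  have h1 : (∫ θ in (0 : ℝ)..π, cosPullback w θ) = ∫ t in (-1 : ℝ)..1, w t := by
    rw [integral_cosPullback w ⟨le_rfl, pi_pos.le⟩ ⟨pi_pos.le, le_rfl⟩]
    simp
  have h2 := integral_cosPullback_neg w 0 π
  rw [neg_zero] at h2
  rw [(cosPullback_periodic w).intervalIntegral_add_eq a (-π), show -π + 2 * π = π by ring,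
    ← intervalIntegral.integral_add_adjacent_intervals (intervalIntegrable_cosPullback hw _ 0)
      (intervalIntegrable_cosPullback hw _ _), h2, h1]
  ring

theorem div_pi_le_sin {x : ℝ} (h0 : 0 ≤ x) (h2 : x ≤ 2) : x / π ≤ Real.sin x := by
  have h1 := mul_le_sin (x := x / 2) (by linarith) (by linarith [pi_gt_three])
  have h3 := one_sub_sq_div_two_le_cos (x := x / 2)
  have h4 : (1 : ℝ) / 2 ≤ Real.cos (x / 2) := by nlinarith
  have h5 : (0 : ℝ) ≤ x / π := div_nonneg h0 pi_pos.le
  have h6 : 2 / π * (x / 2) = x / π := by ring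
  rw [h6] at h1
  have h7 : Real.sin x = 2 * Real.sin (x / 2) * Real.cos (x / 2) := by
    rw [← Real.sin_two_mul]; ring_nf
  rw [h7]
  nlinarith

theorem le_cos_sub_cos_add {a δ : ℝ} (ha : a ∈ Icc 0 (π / 2)) (hδ : 0 < δ) (hδ' : δ ≤ 1 / 2) :
    δ * (a + δ) / 10 ≤ Real.cos a - Real.cos (a + δ) := by
  obtain ⟨ha0, ha1⟩ := ha
  have hpi : π < 3.15 := pi_lt_d2
  have hpi0 := pi_pos
  have h1 := div_pi_le_sin (x := a + δ / 2) (by linarith) (by linarith)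
  have h2 := mul_le_sin (x := δ / 2) (by linarith) (by linarith [pi_gt_three])
  have h3 := two_mul_sin_mul_sin (a + δ / 2) (δ / 2)
  rw [show a + δ / 2 - δ / 2 = a by ring, show a + δ / 2 + δ / 2 = a + δ by ring] at h3
  rw [← h3]
  have h4 : (a + δ / 2) / π * (2 / π * (δ / 2)) ≤ Real.sin (a + δ / 2) * Real.sin (δ / 2) :=
    mul_le_mul h1 h2 (by positivity) ((by positivity : (0 : ℝ) ≤ (a + δ / 2) / π).trans h1)
  have h5 : (a + δ / 2) / π * (2 / π * (δ / 2)) = (a + δ / 2) * δ / π ^ 2 := by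
    field_simp
  have h6 : (a + δ / 2) * δ / 10 ≤ (a + δ / 2) * δ / π ^ 2 := by
    gcongr
    nlinarith
  nlinarith

theorem cos_sub_cos_le {x y : ℝ} (hx : 0 ≤ x) (hxy : x ≤ y) (h : y ≤ π) :
    Real.cos x - Real.cos y ≤ (x + y) * (y - x) / 2 := by
  have h1 := Real.cos_sub_cos y x
  have h2 : Real.sin ((y + x) / 2) ≤ (y + x) / 2 := Real.sin_le (by linarith)
  have h3 : Real.sin ((y - x) / 2) ≤ (y - x) / 2 := Real.sin_le (by linarith)
  have h4 : 0 ≤ Real.sin ((y - x) / 2) :=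
    sin_nonneg_of_nonneg_of_le_pi (by linarith) (by linarith)
  have h5 : Real.sin ((y + x) / 2) * Real.sin ((y - x) / 2) ≤ (y + x) / 2 * ((y - x) / 2) :=
    mul_le_mul h2 h3 h4 (by linarith)
  nlinarith

theorem exists_radius_integral_le {w : ℝ → ℝ} {L : ℝ} (hL : 0 ≤ L) (hw : IsWeight w)
    (hd : IsDoubling w L) {a : ℝ} (ha : a ∈ Icc 0 (π / 2)) {δ : ℝ} (hδ : 0 < δ)
    (hδ' : δ ≤ 1 / 2) :
    ∃ r : ℝ, δ * (a + δ) / 20 ≤ r ∧ ∀ k : ℕ,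
      (∫ t in (Real.cos a - r - 2 ^ k * r)..(Real.cos a - r + 2 ^ k * r), w t) ≤
        L ^ k * ∫ θ in (a - δ)..(a + δ), cosPullback w θ := by
  have hpi := pi_gt_three
  have h1 := le_cos_sub_cos_add ha hδ hδ'
  obtain ⟨ha0, ha1⟩ := ha
  refine ⟨(Real.cos a - Real.cos (a + δ)) / 2, by linarith, fun k => ?_⟩
  set r := (Real.cos a - Real.cos (a + δ)) / 2 with hr
  have hr0 : 0 < r := by
    have : 0 < δ * (a + δ) := by positivity
    linarith
  have hx : Real.cos a - r ∈ Icc (-1 : ℝ) 1 :=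
    ⟨by linarith [neg_one_le_cos (a + δ)], by linarith [cos_le_one a]⟩
  refine (hd.integral_le_pow hL hx hr0 k).trans (mul_le_mul_of_nonneg_left ?_ (pow_nonneg hL k))
  calc _ = ∫ t in (Real.cos (a + δ))..(Real.cos a), w t := by
        congr 1 <;> rw [hr] <;> ring
    _ = ∫ θ in a..(a + δ), cosPullback w θ :=
        (integral_cosPullback w ⟨ha0, by linarith⟩ ⟨by linarith, by linarith⟩).symm
    _ ≤ _ := integral_cosPullback_mono hw (by linarith) (by linarith) le_rfl

theorem integral_cosPullback_le_two_mul {w : ℝ → ℝ} (hw : IsWeight w) {a s : ℝ} (ha : 0 ≤ a)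
    (hs : 0 ≤ s) :
    (∫ θ in (a - s)..(a + s), cosPullback w θ) ≤
      2 * ∫ θ in (max (a - s) 0)..(a + s), cosPullback w θ := by
  have hi := intervalIntegrable_cosPullback hw
  rcases le_total 0 (a - s) with h | h
  · rw [max_eq_left h, two_mul]
    have : 0 ≤ ∫ θ in (a - s)..(a + s), cosPullback w θ :=
      intervalIntegral.integral_nonneg (by linarith) fun θ _ => cosPullback_nonneg hw θ
    linarith
  · rw [max_eq_right h, two_mul,
      ← intervalIntegral.integral_add_adjacent_intervals (hi (a - s) 0) (hi 0 (a + s))]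
    have h1 := integral_cosPullback_neg w 0 (s - a)
    rw [neg_zero, neg_sub] at h1
    rw [h1]
    gcongr
    exact integral_cosPullback_mono hw le_rfl (by linarith) (by linarith)

theorem integral_cosPullback_two_mul_le {w : ℝ → ℝ} {L : ℝ} (hL : 0 ≤ L) (hw : IsWeight w)
    (hd : IsDoubling w L) {a : ℝ} (ha : a ∈ Icc 0 (π / 2)) {δ : ℝ} (hδ : 0 < δ)
    (hδ' : δ ≤ 1 / 2) :
    (∫ θ in (a - 2 * δ)..(a + 2 * δ), cosPullback w θ) ≤
      2 * L ^ 6 * ∫ θ in (a - δ)..(a + δ), cosPullback w θ := by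
  obtain ⟨r, hr, hint⟩ := exists_radius_integral_le hL hw hd ha hδ hδ'
  have hpi := pi_gt_three
  obtain ⟨ha0, ha1⟩ := ha
  have hα0 : 0 ≤ max (a - 2 * δ) 0 := le_max_right _ _
  have hα1 : max (a - 2 * δ) 0 ≤ a := max_le (by linarith) ha0
  have hα2 : a - 2 * δ ≤ max (a - 2 * δ) 0 := le_max_left _ _
  refine (integral_cosPullback_le_two_mul hw ha0 (by linarith)).trans ?_
  rw [mul_assoc]
  refine mul_le_mul_of_nonneg_left (le_trans ?_ (hint 6)) zero_le_two
  set α := max (a - 2 * δ) 0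
  rw [integral_cosPullback w ⟨hα0, by linarith⟩ ⟨by linarith, by linarith⟩]
  have hup := cos_sub_cos_le hα0 hα1 (by linarith)
  have hlo := cos_sub_cos_le ha0 (show a ≤ a + 2 * δ by linarith) (by linarith)
  have hr0 : 0 ≤ r := le_trans (by positivity) hr
  have hprod : (α + a) * (a - α) ≤ 2 * a * (2 * δ) :=
    mul_le_mul (by linarith) (by linarith) (by linarith) (by linarith)
  have hsq : 0 < δ * δ := by positivity
  refine hw.integral_mono ?_ ?_ ?_
  · linarith
  · exact cos_le_cos_of_nonneg_of_le_pi hα0 (by linarith) (by linarith)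
  · linarith

theorem integral_le_integral_cosPullback_half {w : ℝ → ℝ} {L : ℝ} (hL : 0 ≤ L)
    (hw : IsWeight w) (hd : IsDoubling w L) {a : ℝ} (ha : a ∈ Icc 0 (π / 2)) :
    (∫ t in (-1 : ℝ)..1, w t) ≤
      L ^ 8 * ∫ θ in (a - 1 / 2)..(a + 1 / 2), cosPullback w θ := by
  obtain ⟨r, hr, hint⟩ := exists_radius_integral_le hL hw hd ha (δ := 1 / 2) (by norm_num) le_rfl
  have ha0 := ha.1
  have h0 : 0 ≤ Real.cos a := cos_nonneg_of_mem_Icc ⟨by linarith [pi_pos], ha.2⟩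
  refine le_trans (hw.integral_mono ?_ (by norm_num) ?_) (hint 8)
  · linarith [cos_le_one a]
  · linarith

theorem exists_reduction {w : ℝ → ℝ} {L : ℝ} (hw : IsWeight w) (hd : IsDoubling w L) (a : ℝ) :
    ∃ (v : ℝ → ℝ) (b : ℝ), IsWeight v ∧ IsDoubling v L ∧ b ∈ Icc 0 (π / 2) ∧
      (∫ t in (-1 : ℝ)..1, v t) = (∫ t in (-1 : ℝ)..1, w t) ∧
      ∀ s, (∫ θ in (a - s)..(a + s), cosPullback w θ) =
        ∫ θ in (b - s)..(b + s), cosPullback v θ := by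
  set n : ℤ := round (a / π) with hn
  have hpi := pi_pos
  have hb : |a - n * π| ≤ π / 2 := by
    have h1 := abs_sub_round (a / π)
    have h2 : a - n * π = (a / π - n) * π := by field_simp
    rw [h2, abs_mul, abs_of_pos hpi]
    nlinarith
  obtain ⟨v, hv, hvd, hvi, hvw⟩ : ∃ v : ℝ → ℝ, IsWeight v ∧ IsDoubling v L ∧
      (∫ t in (-1 : ℝ)..1, v t) = (∫ t in (-1 : ℝ)..1, w t) ∧
      ∀ θ, cosPullback w (θ + n * π) = cosPullback v θ := by
    rcases Int.even_or_odd n with he | ho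
    · exact ⟨w, hw, hd, rfl, fun θ => by
        simp [cosPullback, cos_add_int_mul_pi, sin_add_int_mul_pi, he.neg_one_zpow]⟩
    · refine ⟨fun t => w (-t), hw.comp_neg, hd.comp_neg, ?_, fun θ => by
        simp [cosPullback, cos_add_int_mul_pi, sin_add_int_mul_pi, ho.neg_one_zpow]⟩
      rw [intervalIntegral.integral_comp_neg, neg_neg]
  have hshift : ∀ s, (∫ θ in (a - s)..(a + s), cosPullback w θ) =
      ∫ θ in (a - n * π - s)..(a - n * π + s), cosPullback v θ := by
    intro s
    simp only [← hvw]
    rw [intervalIntegral.integral_comp_add_right]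
    congr 1 <;> ring
  refine ⟨v, |a - n * π|, hv, hvd, ⟨abs_nonneg _, hb⟩, hvi, fun s => ?_⟩
  rw [hshift s]
  rcases abs_choice (a - n * π) with h | h
  · rw [h]
  · rw [h, ← integral_cosPullback_neg v]
    congr 1 <;> ring

theorem isDoublingPeriodic_cosPullback {w : ℝ → ℝ} {L : ℝ} (hL : 2 ≤ L) (hw : IsWeight w)
    (hd : IsDoubling w L) : IsDoublingPeriodic (cosPullback w) (2 + 4 * L ^ 8) := by
  intro δ hδ a
  have hL0 : 0 ≤ L := by linarith
  obtain ⟨v, b, hv, hvd, hb, hvi, hred⟩ := exists_reduction hw hd a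
  have hpow : L ^ 6 ≤ L ^ 8 := pow_le_pow_right₀ (by linarith) (by norm_num)
  have hI0 : 0 ≤ ∫ θ in (a - δ)..(a + δ), cosPullback w θ :=
    intervalIntegral.integral_nonneg (by linarith) fun θ _ => cosPullback_nonneg hw θ
  rcases le_or_gt δ (1 / 2) with hδ' | hδ'
  · have h := integral_cosPullback_two_mul_le hL0 hv hvd hb hδ hδ'
    rw [← hred, ← hred] at h
    refine h.trans (mul_le_mul_of_nonneg_right ?_ hI0)
    linarith [pow_nonneg hL0 8]
  have hhalf := integral_le_integral_cosPullback_half hL0 hv hvd hb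
  rw [← hred, hvi] at hhalf
  have hsub := integral_cosPullback_mono hw (show a - δ ≤ a - 1 / 2 by linarith)
    (show a - 1 / 2 ≤ a + 1 / 2 by linarith) (show a + 1 / 2 ≤ a + δ by linarith)
  set I := ∫ θ in (a - δ)..(a + δ), cosPullback w θ
  set M := ∫ t in (-1 : ℝ)..1, w t
  have hM : M ≤ L ^ 8 * I := hhalf.trans (mul_le_mul_of_nonneg_left hsub (pow_nonneg hL0 8))
  have hperiods : ∀ (n : ℕ) (t : ℝ),
      (∫ θ in t..(t + n * (2 * π)), cosPullback w θ) = n * (2 * M) := by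
    intro n t
    have := (cosPullback_periodic w).intervalIntegral_add_zsmul_eq n t
      (intervalIntegrable_cosPullback hw)
    rw [integral_cosPullback_period hw] at this
    simpa using this
  set k := ⌊δ / π⌋₊
  have hk1 : k * π ≤ δ := (le_div_iff₀ pi_pos).1 (Nat.floor_le (by positivity))
  have hk2 : δ < (k + 1) * π := (div_lt_iff₀ pi_pos).1 (Nat.lt_floor_add_one _)
  have hk0 : (0 : ℝ) ≤ k * π := by positivity
  have hlow : k * (2 * M) ≤ I := by
    rw [← hperiods k (a - k * π)]
    exact integral_cosPullback_mono hw (by linarith) (by linarith) (by linarith)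
  have hup : (∫ θ in (a - 2 * δ)..(a + 2 * δ), cosPullback w θ) ≤
      (2 * (k + 1) : ℕ) * (2 * M) := by
    rw [← hperiods _ (a - 2 * ((k + 1) * π))]
    refine integral_cosPullback_mono hw (by linarith) (by linarith) ?_
    push_cast
    linarith
  push_cast at hup
  linarith

theorem isPeriodicWeight_cosPullback {w : ℝ → ℝ} (hw : IsWeight w) :
    IsPeriodicWeight (cosPullback w) := by
  refine ⟨(hw.1.comp measurable_cos).mul (by fun_prop), cosPullback_nonneg hw,
    cosPullback_periodic w, intervalIntegrable_cosPullback hw _ _, ?_⟩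
  have h := integral_cosPullback_period hw (-π)
  rw [show -π + 2 * π = π by ring] at h
  rw [h]
  exact mul_pos two_pos hw.2.2.2.2

/-- If `w` is a doubling weight on `[-1,1]` with doubling constant `L`, then
`W(θ) := w(cos θ)|sin θ|` is a `2π`-periodic weight function, doubling with a
doubling constant depending only on `L`. -/
theorem doubling_weight_to_periodic (L : ℝ) (hL : 2 ≤ L) :
    ∃ C > (0:ℝ),
      ∀ w : ℝ → ℝ, IsWeight w → IsDoubling w L →
        IsPeriodicWeight (fun θ => w (Real.cos θ) * |Real.sin θ|) ∧
        IsDoublingPeriodic (fun θ => w (Real.cos θ) * |Real.sin θ|) C := by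
  exact ⟨2 + 4 * L ^ 8, by positivity, fun w hw hd =>
    ⟨isPeriodicWeight_cosPullback hw, isDoublingPeriodic_cosPullback hL hw hd⟩⟩
end
end

section
/- For every integer m ≥ 0, the function F_m is even and is monotonically decreasing on the interval [0, 2π/(2m+1)]. -/
open Real Set

noncomputable section

/-- Variant of the Fejér kernel: `F_m(θ) = (sin((2m+1)θ/2)/((2m+1)sin(θ/2)))²` away from
multiples of `2π` (where `sin(θ/2) = 0`), and `1` at multiples of `2π`. -/
def Fm (m : ℕ) (θ : ℝ) : ℝ :=
  if Real.sin (θ / 2) = 0 then 1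
  else (Real.sin ((2 * m + 1) * θ / 2) / ((2 * m + 1) * Real.sin (θ / 2))) ^ 2

/-- The Dirichlet kernel `1 + 2 ∑_{k=1}^m cos (k θ)`. -/
def dirichletKernel (m : ℕ) (θ : ℝ) : ℝ :=
  1 + 2 * ∑ k ∈ Finset.range m, Real.cos ((k + 1 : ℕ) * θ)

lemma sin_half_mul_dirichletKernel (m : ℕ) (θ : ℝ) :
    Real.sin (θ / 2) * dirichletKernel m θ = Real.sin ((2 * m + 1) * θ / 2) := by
  unfold dirichletKernel
  induction m with
  | zero => simp
  | succ m ih =>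
    have h₁ : (2 * (m : ℝ) + 1) * θ / 2 = (m + 1) * θ - θ / 2 := by ring
    have h₂ : (2 * ((m + 1 : ℕ) : ℝ) + 1) * θ / 2 = (m + 1) * θ + θ / 2 := by
      push_cast; ring
    rw [h₁, Real.sin_sub] at ih
    rw [h₂, Real.sin_add, Finset.sum_range_succ]
    push_cast at ih ⊢
    linear_combination ih

lemma dirichletKernel_of_sin_half_eq_zero (m : ℕ) {θ : ℝ} (h : Real.sin (θ / 2) = 0) :
    dirichletKernel m θ = 2 * m + 1 := by
  obtain ⟨n, hn⟩ := Real.sin_eq_zero_iff.mp h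
  have hcos (k : ℕ) : Real.cos (k * θ) = 1 := by
    rw [Real.cos_eq_one_iff]
    exact ⟨k * n, by push_cast; linear_combination 2 * (k : ℝ) * hn⟩
  simp only [dirichletKernel, hcos, Finset.sum_const, Finset.card_range, nsmul_eq_mul]
  ring

lemma Fm_eq_dirichletKernel_sq (m : ℕ) (θ : ℝ) :
    Fm m θ = (dirichletKernel m θ / (2 * m + 1)) ^ 2 := by
  unfold Fm
  split_ifs with h
  · rw [dirichletKernel_of_sin_half_eq_zero m h, div_self (by positivity), one_pow]
  · rw [← sin_half_mul_dirichletKernel, mul_comm (2 * (m : ℝ) + 1),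
      mul_div_mul_left _ _ h]

lemma dirichletKernel_neg (m : ℕ) (θ : ℝ) :
    dirichletKernel m (-θ) = dirichletKernel m θ := by
  simp [dirichletKernel]

lemma dirichletKernel_antitoneOn (m : ℕ) :
    AntitoneOn (dirichletKernel m) (Icc 0 (2 * π / (2 * m + 1))) := by
  intro x hx y hy hxy
  have hy' := (le_div_iff₀ (by positivity)).mp hy.2
  unfold dirichletKernel
  gcongr with k hk
  have hkm : ((k + 1 : ℕ) : ℝ) ≤ m := by
    exact_mod_cast Finset.mem_range.mp hk
  apply Real.cos_le_cos_of_nonneg_of_le_pi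
  · exact mul_nonneg (by positivity) hx.1
  · nlinarith [mul_le_mul_of_nonneg_right hkm hy.1, hy.1]
  · gcongr

lemma dirichletKernel_nonneg (m : ℕ) {θ : ℝ} (hθ : θ ∈ Icc 0 (2 * π / (2 * m + 1))) :
    0 ≤ dirichletKernel m θ := by
  have hθ' := (le_div_iff₀ (by positivity)).mp hθ.2
  have hmθ : 0 ≤ (m : ℝ) * θ := mul_nonneg (by positivity) hθ.1
  by_cases h : Real.sin (θ / 2) = 0
  · rw [dirichletKernel_of_sin_half_eq_zero m h]
    positivity
  · have hpos : 0 < Real.sin (θ / 2) :=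
      lt_of_le_of_ne (Real.sin_nonneg_of_nonneg_of_le_pi (by linarith [hθ.1]) (by linarith))
        (Ne.symm h)
    refine nonneg_of_mul_nonneg_right ?_ hpos
    rw [sin_half_mul_dirichletKernel]
    exact Real.sin_nonneg_of_nonneg_of_le_pi (by linarith [hθ.1]) (by linarith)

theorem fejer_even_and_decreasing (m : ℕ) :
    (∀ θ : ℝ, Fm m (-θ) = Fm m θ) ∧
    AntitoneOn (Fm m) (Icc 0 (2 * π / (2 * m + 1))) := by
  refine ⟨fun θ => by simp only [Fm_eq_dirichletKernel_sq, dirichletKernel_neg], ?_⟩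
  intro x hx y hy hxy
  simp only [Fm_eq_dirichletKernel_sq]
  have hnonneg := dirichletKernel_nonneg m hy
  have hle := dirichletKernel_antitoneOn m hx hy hxy
  gcongr
end
end

section
/- For every integer m ≥ 1, (2/π)² ≤ F_m(π/(2m+1)) ≤ (2/3)². Moreover, F_m(π/(2m+1)) = ((2m+1)·sin(π/(2(2m+1))))^{-2}, and this quantity is nonincreasing in m. -/
open Real Set

noncomputable section

/-- `x ↦ x * sin (π / (2 * x))` is nondecreasing on `[1, ∞)`, by concavity of the sine. -/
lemma mul_sin_pi_div_two_mul_le {a b : ℝ} (ha : 1 ≤ a) (hab : a ≤ b) :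
    a * Real.sin (π / (2 * a)) ≤ b * Real.sin (π / (2 * b)) := by
  have ha0 : 0 < a := by linarith
  have hb0 : 0 < b := by linarith
  have hx : π / (2 * a) ∈ Icc 0 π := by
    refine ⟨by positivity, ?_⟩
    rw [div_le_iff₀ (by positivity)]
    nlinarith [pi_pos]
  have hw : 0 ≤ 1 - a / b := sub_nonneg.2 ((div_le_one hb0).2 hab)
  have h := strictConcaveOn_sin_Icc.concaveOn.2 hx (⟨le_rfl, pi_pos.le⟩ : (0 : ℝ) ∈ Icc 0 π)
    (by positivity : 0 ≤ a / b) hw (by ring)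
  have he : a / b * (π / (2 * a)) = π / (2 * b) := by field_simp
  simp only [smul_eq_mul, mul_zero, add_zero, Real.sin_zero, he] at h
  calc a * Real.sin (π / (2 * a)) = b * (a / b * Real.sin (π / (2 * a))) := by field_simp
    _ ≤ b * Real.sin (π / (2 * b)) := mul_le_mul_of_nonneg_left h hb0.le

lemma sin_pi_div_two_mul_pos {a : ℝ} (ha : 1 ≤ a) : 0 < Real.sin (π / (2 * a)) := by
  refine Real.sin_pos_of_pos_of_lt_pi (by positivity) ?_
  rw [div_lt_iff₀ (by positivity)]
  nlinarith [pi_pos]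

lemma Fm_pi_div (m : ℕ) :
    Fm m (π / (2 * m + 1)) = (((2 * m + 1) * Real.sin (π / (2 * (2 * m + 1)))) ^ 2)⁻¹ := by
  have hN : (1 : ℝ) ≤ 2 * m + 1 := by linarith [(Nat.cast_nonneg m : (0 : ℝ) ≤ m)]
  have h1 : π / (2 * m + 1) / 2 = π / (2 * (2 * m + 1)) := by field_simp
  have h2 : (2 * m + 1) * (π / (2 * m + 1)) / 2 = π / 2 := by field_simp
  rw [Fm, h1, h2, if_neg (sin_pi_div_two_mul_pos hN).ne', Real.sin_pi_div_two, div_pow, one_pow,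
    one_div]

theorem fejer_value_at_pi_over (m : ℕ) (hm : 1 ≤ m) :
    ((2 / π) ^ 2 ≤ Fm m (π / (2 * m + 1)) ∧ Fm m (π / (2 * m + 1)) ≤ (2 / 3) ^ 2) ∧
    Fm m (π / (2 * m + 1)) = (((2 * m + 1) * Real.sin (π / (2 * (2 * m + 1)))) ^ 2)⁻¹ ∧
    (∀ m' : ℕ, m ≤ m' → Fm m' (π / (2 * m' + 1)) ≤ Fm m (π / (2 * m + 1))) := by
  have hpos (a : ℝ) (ha : 1 ≤ a) : 0 < a * Real.sin (π / (2 * a)) :=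
    mul_pos (by linarith) (sin_pi_div_two_mul_pos ha)
  have hm' : (1 : ℝ) ≤ m := by exact_mod_cast hm
  have hN : (1 : ℝ) ≤ 2 * m + 1 := by linarith
  refine ⟨⟨?_, ?_⟩, Fm_pi_div m, fun m' hmm' => ?_⟩
  · rw [Fm_pi_div, ← inv_div π 2, inv_pow]
    have hp := hpos _ hN
    gcongr
    calc (2 * m + 1) * Real.sin (π / (2 * (2 * m + 1)))
        ≤ (2 * m + 1) * (π / (2 * (2 * m + 1))) := by
          gcongr
          exact Real.sin_le (by positivity)
      _ = π / 2 := by field_simp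
  · rw [Fm_pi_div, ← inv_div (3 : ℝ) 2, inv_pow]
    have h := mul_sin_pi_div_two_mul_le (a := 3) (b := 2 * m + 1) (by norm_num) (by linarith)
    rw [show π / (2 * 3) = π / 6 by norm_num, Real.sin_pi_div_six] at h
    gcongr
    linarith
  · rw [Fm_pi_div, Fm_pi_div]
    have hp := hpos _ hN
    have hmm : (m : ℝ) ≤ m' := by exact_mod_cast hmm'
    have h := mul_sin_pi_div_two_mul_le hN (by linarith : 2 * (m : ℝ) + 1 ≤ 2 * m' + 1)
    exact inv_anti₀ (by positivity) (pow_le_pow_left₀ hp.le h 2)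
end
end

section
/- Let n be a positive integer and let W be a 2π-periodic weight function. Let 0 < η < 1 and let D ⊂ [-π, π] be a Lebesgue measurable set with |D| ≤ (1-η)²·2π/(2n+1), and suppose E := essinf_{θ ∈ [-π,π]\D} W(θ) > 0. Then for every integer N ≥ (1/η)·(∫_{-π}^{π} W(θ)dθ / E)·n, there exists a Chebyshev-type trigonometric quadrature of degree n for W with exactly N nodes. -/
open MeasureTheory Real Set

noncomputable section
/-- A Chebyshev-type trigonometric quadrature of degree `n` for `W` with `N` nodes. -/
def IsTrigChebQuad (W : ℝ → ℝ) (n N : ℕ) (θs : Fin N → ℝ) : Prop :=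
  Monotone θs ∧
  ∀ p : ℝ → ℝ, IsTrigPoly n p →
    (∫ θ in (-π)..π, p θ * W θ) =
      ((∫ θ in (-π)..π, W θ) / N) * ∑ i, p (θs i)

open Polynomial in
/-- Evaluation at `1` is a fixed combination of evaluations at points near `0`. -/
theorem exists_extrapolation_weights (m : ℕ) {δ : ℝ} (hδ : 0 < δ) :
    ∃ t w : Fin (m + 1) → ℝ, (∀ k, t k ∈ Ioo 0 δ) ∧
      ∀ P : ℝ[X], P.natDegree ≤ m → P.eval 1 = ∑ k, w k * P.eval (t k) := by
  let t : Fin (m + 1) → ℝ := fun k => δ * ((k : ℝ) + 1) / (m + 2)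
  have ht : Function.Injective t := by
    intro i j h
    have h2 : (0 : ℝ) < m + 2 := by positivity
    simp only [t] at h
    field_simp at h
    have : (i : ℝ) = j := by linarith
    exact Fin.ext (by exact_mod_cast this)
  refine ⟨t, fun k => (Lagrange.basis Finset.univ t k).eval 1, fun k => ⟨by positivity, ?_⟩, ?_⟩
  · have h2 : (0 : ℝ) < m + 2 := by positivity
    have : (k : ℝ) ≤ m := by exact_mod_cast Nat.lt_succ_iff.mp k.2
    rw [div_lt_iff₀ h2]
    nlinarith
  · intro P hP
    have hdeg : P.degree < (Finset.univ : Finset (Fin (m + 1))).card := by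
      rw [Finset.card_univ, Fintype.card_fin]
      exact (degree_le_of_natDegree_le hP).trans_lt (by exact_mod_cast Nat.lt_succ_self m)
    conv_lhs => rw [Lagrange.eq_interpolate ht.injOn hdeg]
    simp [Lagrange.interpolate_apply, eval_finsetSum, mul_comm]

section
variable {E : Type*} [NormedAddCommGroup E] [InnerProductSpace ℝ E] [FiniteDimensional ℝ E]

open Polynomial in
theorem exists_polynomial_det_one_add_smul (A : E →L[ℝ] E) :
    ∃ P : ℝ[X], P.natDegree ≤ Module.finrank ℝ E ∧
      ∀ t : ℝ, P.eval t = (1 + t • A).det := by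
  let b := Module.finBasis ℝ E
  let M := LinearMap.toMatrix b b (A : E →ₗ[ℝ] E)
  refine ⟨Matrix.det ((X : ℝ[X]) • M.map C + (1 : Matrix _ _ ℝ).map C), ?_, fun t => ?_⟩
  · simpa using natDegree_det_X_add_C_le M 1
  · rw [eval_det, ContinuousLinearMap.det, ← LinearMap.det_toMatrix b]
    congr 1
    ext i j
    simp only [M]
    simp [Matrix.one_apply]
    ring

theorem det_one_add_pos_of_norm_lt_one {A : E →L[ℝ] E} (hA : ‖A‖ < 1) : 0 < (1 + A).det := by
  have hne : ∀ s ∈ Icc (0 : ℝ) 1, (1 + s • A).det ≠ 0 := by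
    intro s hs
    have : ‖-(s • A)‖ < 1 := by
      rw [norm_neg, norm_smul, Real.norm_of_nonneg hs.1]
      nlinarith [norm_nonneg A, hs.2]
    have hu := isUnit_one_sub_of_norm_lt_one this
    rw [sub_neg_eq_add] at hu
    have h2 : IsUnit ((1 + s • A : E →L[ℝ] E) : E →ₗ[ℝ] E) :=
      hu.map ContinuousLinearMap.toLinearMapRingHom
    exact (h2.map LinearMap.det).ne_zero
  obtain ⟨P, -, hP⟩ := exists_polynomial_det_one_add_smul A
  by_contra hcon
  have h1 : (1 + (1 : ℝ) • A).det ≤ 0 := by simpa using hcon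
  have h0 : (0 : ℝ) ≤ (1 + (0 : ℝ) • A).det := by simp [ContinuousLinearMap.det]
  have hc : ContinuousOn (fun s : ℝ => (1 + s • A).det) (Icc 0 1) := by
    simp_rw [← hP]; exact P.continuous.continuousOn
  obtain ⟨s, hs, hs0⟩ := intermediate_value_Icc' zero_le_one hc ⟨h1, h0⟩
  exact hne s hs hs0

variable [MeasurableSpace E] [BorelSpace E]

theorem integral_det_one_add_smul_fderiv_of_small {g : E → E} (hg : ContDiff ℝ 1 g) {r : ℝ}
    (hr : 0 < r) (hS : ∀ x, ‖x‖ = r → g x = 0) (hB : ∀ x, ‖x‖ ≤ r → ‖x + g x‖ ≤ r)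
    {C : NNReal} (hC : ∀ x ∈ Metric.closedBall (0 : E) r, ‖fderiv ℝ g x‖₊ ≤ C)
    {t : ℝ} (ht : t ∈ Ioo (0 : ℝ) 1) (htC : t * C < 1) :
    ∫ x in Metric.ball (0 : E) r, (1 + t • fderiv ℝ g x).det =
      volume.real (Metric.ball (0 : E) r) := by
  have hlip : LipschitzOnWith C g (Metric.closedBall 0 r) :=
    Convex.lipschitzOnWith_of_nnnorm_fderiv_le
      (fun x _ => hg.differentiable one_ne_zero x) hC (convex_closedBall 0 r)
  set h : E → E := fun x => x + t • g x with hh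
  have hcont : Continuous h := by have := hg.continuous; fun_prop
  have hinj : InjOn h (Metric.closedBall 0 r) := by
    intro x hx y hy hxy
    have h1 : x - y = t • (g y - g x) := by
      simp only [hh] at hxy
      rw [smul_sub, sub_eq_sub_iff_add_eq_add, hxy, add_comm]
    have h2 : ‖g y - g x‖ ≤ C * ‖x - y‖ := by
      rw [norm_sub_rev x y]; exact hlip.norm_sub_le hy hx
    have h3 : ‖x - y‖ ≤ t * C * ‖x - y‖ := by
      calc ‖x - y‖ = t * ‖g y - g x‖ := by
            conv_lhs => rw [h1, norm_smul, Real.norm_of_nonneg ht.1.le]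
        _ ≤ t * (C * ‖x - y‖) := by gcongr; exact ht.1.le
        _ = _ := by ring
    have h4 : ‖x - y‖ = 0 := by nlinarith [norm_nonneg (x - y)]
    exact sub_eq_zero.mp (norm_eq_zero.mp h4)
  have hder : ∀ x, HasStrictFDerivAt h (1 + t • fderiv ℝ g x) x := fun x =>
    (hasStrictFDerivAt_id x).add ((hg.contDiffAt.hasStrictFDerivAt one_ne_zero).const_smul t)
  have hnorm : ∀ x ∈ Metric.closedBall (0 : E) r, ‖t • fderiv ℝ g x‖ < 1 := by
    intro x hx
    rw [norm_smul, Real.norm_of_nonneg ht.1.le]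
    refine lt_of_le_of_lt ?_ htC
    have : ‖fderiv ℝ g x‖ ≤ C := hC x hx
    gcongr; exact ht.1.le
  have hpos : ∀ x ∈ Metric.closedBall (0 : E) r, 0 < (1 + t • fderiv ℝ g x).det :=
    fun x hx => det_one_add_pos_of_norm_lt_one (hnorm x hx)
  have hopen : IsOpen (h '' Metric.ball 0 r) := by
    rw [isOpen_iff_mem_nhds]
    rintro _ ⟨x, hx, rfl⟩
    have hsurj : (1 + t • fderiv ℝ g x : E →L[ℝ] E).range = ⊤ := by
      rw [← LinearMap.isUnit_iff_range_eq_top, LinearMap.isUnit_iff_isUnit_det]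
      exact (hpos x (Metric.ball_subset_closedBall hx)).ne'.isUnit
    rw [← (hder x).map_nhds_eq_of_surj hsurj]
    exact Filter.image_mem_map (Metric.isOpen_ball.mem_nhds hx)
  have hmaps : h '' Metric.closedBall 0 r ⊆ Metric.closedBall 0 r := by
    rintro _ ⟨x, hx, rfl⟩
    rw [mem_closedBall_zero_iff] at hx ⊢
    have : h x = (1 - t) • x + t • (x + g x) := by simp only [hh]; module
    rw [this]
    calc _ ≤ (1 - t) * ‖x‖ + t * ‖x + g x‖ := by
          refine (norm_add_le _ _).trans ?_
          rw [norm_smul, norm_smul, Real.norm_of_nonneg ht.1.le,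
            Real.norm_of_nonneg (by linarith [ht.2])]
      _ ≤ (1 - t) * r + t * r := by
          have := hB x hx
          have := ht.1
          have := ht.2
          gcongr
      _ = r := by ring
  have hsub : h '' Metric.ball 0 r ⊆ Metric.ball 0 r := by
    have := hopen.subset_interior_iff.mpr
      ((image_mono Metric.ball_subset_closedBall).trans hmaps)
    rwa [interior_closedBall (0 : E) hr.ne'] at this
  have hsup : Metric.ball 0 r ⊆ h '' Metric.ball 0 r := by
    refine IsPreconnected.subset_of_closure_inter_subset
      (convex_ball (0 : E) r).isPreconnected hopen ?_ ?_
    · have h0 : (0 : E) ∈ Metric.ball 0 r := Metric.mem_ball_self hr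
      exact ⟨h 0, hsub (mem_image_of_mem h h0), mem_image_of_mem h h0⟩
    · rintro y ⟨hy, hyr⟩
      have hcl : closure (h '' Metric.ball 0 r) ⊆ h '' Metric.closedBall 0 r :=
        closure_minimal (image_mono Metric.ball_subset_closedBall)
          ((isCompact_closedBall (0 : E) r).image hcont).isClosed
      obtain ⟨x, hx, rfl⟩ := hcl hy
      rw [mem_closedBall_zero_iff] at hx
      rcases hx.lt_or_eq with hlt | heq
      · exact mem_image_of_mem h (mem_ball_zero_iff.mpr hlt)
      · have : h x = x := by simp [hh, hS x heq]
        rw [this, mem_ball_zero_iff] at hyr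
        exact absurd heq hyr.ne
  have himg : h '' Metric.ball 0 r = Metric.ball 0 r := hsub.antisymm hsup
  have key := integral_image_eq_integral_abs_det_fderiv_smul volume
    (Metric.isOpen_ball (x := (0 : E)) (ε := r)).measurableSet
    (fun x _ => (hder x).hasFDerivAt.hasFDerivWithinAt)
    (hinj.mono Metric.ball_subset_closedBall) (fun _ => (1 : ℝ))
  rw [himg] at key
  simp only [smul_eq_mul, mul_one, integral_const, measureReal_restrict_apply_univ] at key
  rw [key]
  refine setIntegral_congr_fun Metric.isOpen_ball.measurableSet fun x hx => ?_
  exact (abs_of_pos (hpos x (Metric.ball_subset_closedBall hx))).symm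

/-- There is no continuously differentiable retraction of a ball onto its boundary sphere. -/
theorem no_contDiff_retraction {f : E → E} (hf : ContDiff ℝ 1 f) {r : ℝ} (hr : 0 < r)
    (hS : ∀ x, ‖x‖ = r → f x = x) (hn : ∀ x, ‖f x‖ = r) : False := by
  set g : E → E := fun x => f x - x with hgdef
  have hg : ContDiff ℝ 1 g := hf.sub contDiff_id
  have hDc : Continuous (fderiv ℝ g) := hg.continuous_fderiv one_ne_zero
  obtain ⟨C₀, hC₀⟩ := (isCompact_closedBall (0 : E) r).exists_bound_of_continuousOn hDc.continuousOn
  set C : NNReal := Real.toNNReal C₀ with hCdef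
  have hC : ∀ x ∈ Metric.closedBall (0 : E) r, ‖fderiv ℝ g x‖₊ ≤ C := by
    intro x hx
    rw [← NNReal.coe_le_coe, coe_nnnorm, hCdef]
    exact (hC₀ x hx).trans (Real.le_coe_toNNReal C₀)
  have hδ : (0 : ℝ) < min 1 (1 / ((C : ℝ) + 1)) := by positivity
  obtain ⟨t, w, ht, hw⟩ := exists_extrapolation_weights (Module.finrank ℝ E) hδ
  have hsmall : ∀ k, ∫ x in Metric.ball (0 : E) r, (1 + t k • fderiv ℝ g x).det =
      volume.real (Metric.ball (0 : E) r) := by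
    intro k
    have hk1 := (lt_min_iff.mp (ht k).2).1
    have hk2 := (lt_min_iff.mp (ht k).2).2
    refine integral_det_one_add_smul_fderiv_of_small hg hr (fun x hx => by simp [hgdef, hS x hx])
      (fun x _ => by simp [hgdef, hn x]) hC ⟨(ht k).1, hk1⟩ ?_
    rw [lt_div_iff₀ (by positivity)] at hk2
    nlinarith [(ht k).1]
  have hzero : ∀ x, (1 + (1 : ℝ) • fderiv ℝ g x).det = 0 := by
    intro x
    have hfd : (1 : E →L[ℝ] E) + (1 : ℝ) • fderiv ℝ g x = fderiv ℝ f x := by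
      have : fderiv ℝ g x = fderiv ℝ f x - 1 := by
        rw [hgdef, fderiv_fun_sub (hf.differentiable one_ne_zero x) differentiableAt_fun_id]
        simp
        rfl
      rw [this]; simp
    rw [hfd]
    by_contra hdet
    have hu : IsUnit (fderiv ℝ f x : E →ₗ[ℝ] E) := by
      rw [LinearMap.isUnit_iff_isUnit_det]
      exact (Ne.isUnit hdet)
    have hsurj := LinearMap.range_eq_top.mp ((LinearMap.isUnit_iff_range_eq_top _).mp hu)
    obtain ⟨v, hv⟩ := hsurj (f x)
    have hd : HasFDerivAt (fun y => ‖f y‖ ^ 2) (2 • (innerSL ℝ (f x)).comp (fderiv ℝ f x)) x :=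
      (hf.differentiable one_ne_zero x).hasFDerivAt.norm_sq
    have hd' : HasFDerivAt (fun y => ‖f y‖ ^ 2) (0 : E →L[ℝ] ℝ) x := by
      simp_rw [hn]; exact hasFDerivAt_const _ _
    have h0 := congrArg (fun L => L v) (hd.unique hd')
    have hv' : fderiv ℝ f x v = f x := hv
    simp [hv', hn x] at h0
    linarith
  choose P hPdeg hP using fun x => exists_polynomial_det_one_add_smul (fderiv ℝ g x)
  have hcontdet : ∀ s : ℝ, Continuous fun x => (1 + s • fderiv ℝ g x).det := fun s =>
    ContinuousLinearMap.continuous_det.comp (by fun_prop)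
  have hρint : ∀ k, IntegrableOn (fun x => (1 + t k • fderiv ℝ g x).det) (Metric.ball (0 : E) r) :=
    fun k => ((hcontdet _).continuousOn.integrableOn_compact
      (isCompact_closedBall (0 : E) r)).mono_set Metric.ball_subset_closedBall
  have hsum : ∑ k, w k = 1 := by
    have := hw 1 (by simp)
    simpa using this.symm
  have hfinal : (0 : ℝ) = volume.real (Metric.ball (0 : E) r) := by
    calc (0 : ℝ) = ∫ x in Metric.ball (0 : E) r, ∑ k, w k * (1 + t k • fderiv ℝ g x).det := by
          rw [← integral_zero E ℝ (μ := volume.restrict (Metric.ball (0 : E) r))]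
          congr 1
          ext x
          rw [← hzero x, ← hP, hw _ (hPdeg x)]
          simp_rw [hP]
      _ = ∑ k, w k * ∫ x in Metric.ball (0 : E) r, (1 + t k • fderiv ℝ g x).det := by
          rw [integral_finsetSum _ fun k _ => (hρint k).const_mul _]
          simp_rw [integral_const_mul]
      _ = _ := by
          simp_rw [hsmall, ← Finset.sum_mul, hsum, one_mul]
  have hvol : 0 < volume.real (Metric.ball (0 : E) r) :=
    ENNReal.toReal_pos (Metric.measure_ball_pos volume 0 hr).ne' measure_ball_lt_top.ne
  exact hvol.ne hfinal

end

/-- A continuous vector field pointing outwards away from the open unit ball has a zero. -/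
theorem exists_zero_of_inner_pos {E : Type*} [NormedAddCommGroup E] [InnerProductSpace ℝ E]
    [FiniteDimensional ℝ E] {G : E → E} (hG : Continuous G)
    (hpos : ∀ x, 1 ≤ ‖x‖ → 0 < inner ℝ (G x) x) : ∃ x, G x = 0 := by
  by_contra! hne
  borelize E
  set l : E → ℝ := fun x => max 0 (min 1 (‖x‖ - 1)) with hl
  set H : E → E := fun x => (1 - l x) • G x + l x • x with hH
  have hHc : Continuous H := by fun_prop
  have hH0 : ∀ x, H x ≠ 0 := by
    intro x hx
    rcases le_total ‖x‖ 1 with h | h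
    · have : l x = 0 := by
        simp only [hl]; rw [max_eq_left]; exact (min_le_right _ _).trans (by linarith)
      simp only [hH, this] at hx
      exact hne x (by simpa using hx)
    · have h0 : 0 ≤ l x := le_max_left _ _
      have h1 : l x ≤ 1 := max_le zero_le_one (min_le_left _ _)
      have h2 : inner ℝ (H x) x = (1 - l x) * inner ℝ (G x) x + l x * ‖x‖ ^ 2 := by
        simp only [hH]
        rw [inner_add_left, real_inner_smul_left, real_inner_smul_left, real_inner_self_eq_norm_sq]
      rw [hx, inner_zero_left] at h2
      have h3 := hpos x h
      have h4 : 0 < ‖x‖ ^ 2 := by positivity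
      rcases h1.lt_or_eq with h5 | h5
      · have := mul_pos (sub_pos.mpr h5) h3
        have := mul_nonneg h0 h4.le
        linarith
      · rw [h5] at h2; linarith
  have hHout : ∀ x, 2 ≤ ‖x‖ → H x = x := by
    intro x hx
    have : l x = 1 := by
      simp only [hl]; rw [min_eq_left (by linarith)]; simp
    simp [hH, this]
  obtain ⟨g, hgc, hgd, hgS, -⟩ := hHc.exists_contDiff_approx_and_eqOn (ε := fun x => ‖H x‖) 1
    hHc.norm (fun x => norm_pos_iff.mpr (hH0 x))
    (S := {x | 3 ≤ ‖x‖}) (U := {x | 2 < ‖x‖}) (isClosed_le continuous_const continuous_norm)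
    ((isOpen_lt continuous_const continuous_norm).mem_nhdsSet.mpr fun x (hx : 3 ≤ ‖x‖) =>
      show 2 < ‖x‖ by linarith)
    (contDiffOn_id.congr fun x hx => hHout x (le_of_lt hx))
  have hg0 : ∀ x, g x ≠ 0 := by
    intro x hx
    have := hgd x
    rw [hx, dist_zero_left] at this
    exact lt_irrefl _ this
  refine no_contDiff_retraction (f := fun x => (3 * ‖g x‖⁻¹) • g x) (r := 3) ?_ (by norm_num)
    (fun x hx => ?_) (fun x => ?_)
  · exact (contDiff_const.mul ((hgc.norm ℝ hg0).inv fun x => norm_ne_zero_iff.mpr (hg0 x))).smul hgc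
  · have : g x = x := (hgS (show 3 ≤ ‖x‖ by rw [hx])).trans (hHout x (by rw [hx]; norm_num))
    simp [this, hx]
  · have := norm_pos_iff.mpr (hg0 x)
    rw [norm_smul, norm_mul, norm_inv, norm_norm, mul_assoc, inv_mul_cancel₀ this.ne']
    norm_num

/-- A family of functions growing at a uniform positive rate has continuous level points. -/
theorem exists_continuous_level {X : Type*} [TopologicalSpace X] {F : X → ℝ → ℝ} {κ : ℝ}
    (hκ : 0 < κ) (hgrow : ∀ c u v, u ≤ v → κ * (v - u) ≤ F c v - F c u)
    (hFt : ∀ c, Continuous (F c)) (hFc : ∀ t, Continuous fun c => F c t)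
    {L : X → ℝ} (hL : Continuous L) :
    ∃ Q : X → ℝ, Continuous Q ∧ ∀ c, F c (Q c) = L c := by
  have hsurj : ∀ c, Function.Surjective (F c) := by
    intro c
    refine (hFt c).surjective ?_ ?_
    · refine Filter.tendsto_atTop_mono' _ (f₁ := fun t => F c 0 + κ * t) ?_
        (Filter.tendsto_atTop_add_const_left _ _ (Filter.tendsto_id.const_mul_atTop hκ))
      filter_upwards [Filter.eventually_ge_atTop 0] with t ht
      have := hgrow c 0 t ht
      linarith
    · refine Filter.tendsto_atBot_mono' _ (f₁ := fun t => F c 0 + κ * t) ?_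
        (Filter.tendsto_atBot_add_const_left _ _ (Filter.tendsto_id.const_mul_atBot hκ))
      filter_upwards [Filter.eventually_le_atBot 0] with t ht
      have := hgrow c t 0 ht
      linarith
  choose Q hQ using fun c => hsurj c (L c)
  refine ⟨Q, continuous_iff_continuousAt.mpr fun c => ?_, hQ⟩
  have hbound : ∀ c', |Q c' - Q c| ≤ |L c' - F c' (Q c)| / κ := by
    intro c'
    rw [le_div_iff₀ hκ, ← hQ c']
    rcases le_total (Q c) (Q c') with h | h
    · have := hgrow c' _ _ h
      rw [abs_of_nonneg (sub_nonneg.mpr h)]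
      exact le_trans (by linarith) (le_abs_self _)
    · have := hgrow c' _ _ h
      rw [abs_of_nonpos (sub_nonpos.mpr h)]
      exact le_trans (by linarith) (neg_le_abs _)
  have hlim : Filter.Tendsto (fun c' => |L c' - F c' (Q c)| / κ) (nhds c) (nhds 0) := by
    have hc : Continuous fun c' => |L c' - F c' (Q c)| / κ :=
      ((hL.sub (hFc (Q c))).abs).div_const κ
    simpa [hQ c] using hc.tendsto c
  rw [ContinuousAt, tendsto_iff_dist_tendsto_zero]
  exact squeeze_zero (fun _ => dist_nonneg) hbound hlim

theorem abs_integral_mul_sub_le {p ρ : ℝ → ℝ} (hp : ContDiff ℝ 1 p)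
    (hρ : ∀ u v, IntervalIntegrable ρ volume u v) (hρ0 : ∀ t, 0 ≤ ρ t) {u v m : ℝ}
    (hm : m ∈ Icc u v) :
    |(∫ t in u..v, p t * ρ t) - p m * ∫ t in u..v, ρ t| ≤
      (∫ t in u..v, |deriv p t|) * ∫ t in u..v, ρ t := by
  have huv : u ≤ v := hm.1.trans hm.2
  have hd : Continuous (deriv p) := hp.continuous_deriv_one
  have hpρ : IntervalIntegrable (fun t => p t * ρ t) volume u v :=
    (hρ u v).continuousOn_mul hp.continuous.continuousOn
  have hpt : ∀ t ∈ Icc u v, |p t - p m| ≤ ∫ s in u..v, |deriv p s| := by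
    intro t ht
    have hftc : ∫ s in m..t, deriv p s = p t - p m :=
      intervalIntegral.integral_deriv_eq_sub (fun x _ => hp.differentiable one_ne_zero x)
        (hd.intervalIntegrable _ _)
    rw [← hftc]
    calc |(∫ s in m..t, deriv p s)| ≤ |(∫ s in m..t, |deriv p s|)| :=
          by simpa only [Real.norm_eq_abs] using
            intervalIntegral.norm_integral_le_abs_integral_norm (f := deriv p) (a := m) (b := t)
      _ ≤ |(∫ s in u..v, |deriv p s|)| := by
          refine intervalIntegral.abs_integral_mono_interval ?_
            (Filter.Eventually.of_forall fun _ => abs_nonneg _) (hd.abs.intervalIntegrable _ _)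
          rw [uIoc_of_le huv]
          rintro x ⟨hx1, hx2⟩
          exact ⟨lt_of_le_of_lt (le_min hm.1 ht.1) hx1, hx2.trans (max_le hm.2 ht.2)⟩
      _ = ∫ s in u..v, |deriv p s| :=
          abs_of_nonneg (intervalIntegral.integral_nonneg huv fun _ _ => abs_nonneg _)
  have heq : (∫ t in u..v, p t * ρ t) - p m * ∫ t in u..v, ρ t =
      ∫ t in u..v, (p t - p m) * ρ t := by
    rw [← intervalIntegral.integral_const_mul,
      ← intervalIntegral.integral_sub hpρ ((hρ u v).const_mul _)]
    simp_rw [sub_mul]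
  rw [heq, ← intervalIntegral.integral_const_mul]
  refine (intervalIntegral.abs_integral_le_integral_abs huv).trans
    (intervalIntegral.integral_mono_on huv ?_ ((hρ u v).const_mul _) fun t ht => ?_)
  · exact ((hρ u v).continuousOn_mul (hp.continuous.sub continuous_const).continuousOn).abs
  · rw [abs_mul, abs_of_nonneg (hρ0 t)]
    exact mul_le_mul_of_nonneg_right (hpt t ht) (hρ0 t)

/-- Midpoint quantiles of a density integrate a function up to its total variation. -/
theorem abs_integral_mul_sub_sum_quantiles_le {p ρ : ℝ → ℝ} (hp : ContDiff ℝ 1 p)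
    (hρ : ∀ u v, IntervalIntegrable ρ volume u v) (hρ0 : ∀ t, 0 ≤ ρ t) {N : ℕ} {q : ℕ → ℝ}
    (hq : Monotone q) {δ : ℝ} (hδ : ∀ k, ∫ t in (q k)..(q (k + 1)), ρ t = δ) :
    |(∫ t in (q 0)..(q (2 * N)), p t * ρ t) - 2 * δ * ∑ i ∈ Finset.range N, p (q (2 * i + 1))| ≤
      δ * ∫ t in (q 0)..(q (2 * N)), |deriv p t| := by
  have hd : Continuous (deriv p) := hp.continuous_deriv_one
  have hpρ : ∀ u v, IntervalIntegrable (fun t => p t * ρ t) volume u v := fun u v =>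
    (hρ u v).continuousOn_mul hp.continuous.continuousOn
  have hdi : ∀ u v, IntervalIntegrable (fun t => |deriv p t|) volume u v := fun u v =>
    hd.abs.intervalIntegrable _ _
  induction N with
  | zero => simp
  | succ N ih =>
    have h1 := abs_integral_mul_sub_le hp hρ hρ0
      (show q (2 * N + 1) ∈ Icc (q (2 * N)) (q (2 * N + 1)) from ⟨hq (by lia), le_rfl⟩)
    have h2 := abs_integral_mul_sub_le hp hρ hρ0
      (show q (2 * N + 1) ∈ Icc (q (2 * N + 1)) (q (2 * N + 1 + 1)) from ⟨le_rfl, hq (by lia)⟩)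
    rw [hδ] at h1 h2
    rw [Finset.sum_range_succ, show 2 * (N + 1) = 2 * N + 1 + 1 by ring,
      ← intervalIntegral.integral_add_adjacent_intervals (hpρ _ (q (2 * N + 1))) (hpρ _ _),
      ← intervalIntegral.integral_add_adjacent_intervals (hpρ _ (q (2 * N))) (hpρ _ _),
      ← intervalIntegral.integral_add_adjacent_intervals (hdi _ (q (2 * N + 1))) (hdi _ _),
      ← intervalIntegral.integral_add_adjacent_intervals (hdi _ (q (2 * N))) (hdi _ _)]
    rw [abs_le] at h1 h2 ih ⊢
    constructor <;> linarith [h1.1, h1.2, h2.1, h2.2, ih.1, ih.2]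

/-- A positive density concentrating the weight `W` on the set where `p` is positive. -/
def positivePartDensity (p W : ℝ → ℝ) (R κ : ℝ) (t : ℝ) : ℝ :=
  max (p t) 0 / (max (p t) 0 + R) * W t + κ

section
variable {p W : ℝ → ℝ} {R κ : ℝ}

theorem positivePart_div_mem_Icc (x : ℝ) (hR : 0 < R) : max x 0 / (max x 0 + R) ∈ Icc (0 : ℝ) 1 := by
  have h : 0 ≤ max x 0 := le_max_right _ _
  exact ⟨by positivity, div_le_one_of_le₀ (by linarith) (by positivity)⟩

theorem le_positivePartDensity (hW0 : ∀ t, 0 ≤ W t) (hR : 0 < R) (t : ℝ) :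
    κ ≤ positivePartDensity p W R κ t := by
  have := mul_nonneg (positivePart_div_mem_Icc (p t) hR).1 (hW0 t)
  unfold positivePartDensity
  linarith

theorem positivePartDensity_le (hW0 : ∀ t, 0 ≤ W t) (hR : 0 < R) (t : ℝ) :
    positivePartDensity p W R κ t ≤ W t + κ := by
  have := mul_le_mul_of_nonneg_right (positivePart_div_mem_Icc (p t) hR).2 (hW0 t)
  unfold positivePartDensity
  linarith

theorem intervalIntegrable_positivePartDensity (hp : Continuous p)
    (hWi : ∀ u v, IntervalIntegrable W volume u v) (hR : 0 < R) (u v : ℝ) :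
    IntervalIntegrable (positivePartDensity p W R κ) volume u v := by
  refine ((hWi u v).continuousOn_mul (Continuous.continuousOn ?_)).add intervalIntegrable_const
  refine (hp.max continuous_const).div ((hp.max continuous_const).add continuous_const) fun t => ?_
  have h : 0 ≤ max (p t) 0 := le_max_right _ _
  positivity

theorem le_integral_mul_positivePartDensity (hp : Continuous p)
    (hW0 : ∀ t, 0 ≤ W t) (hWi : ∀ u v, IntervalIntegrable W volume u v)
    (hmean : ∫ t in (-π)..π, p t * W t = 0) (hR : 0 < R) (hκ : 0 ≤ κ) {B : ℝ}
    (hB : ∀ t, |p t| ≤ B) :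
    (∫ t in (-π)..π, |p t| * W t) / 2 - R * (∫ t in (-π)..π, W t) - 2 * π * κ * B ≤
      ∫ t in (-π)..π, p t * positivePartDensity p W R κ t := by
  have hpW : IntervalIntegrable (fun t => p t * W t) volume (-π) π :=
    (hWi _ _).continuousOn_mul hp.continuousOn
  have hapW : IntervalIntegrable (fun t => |p t| * W t) volume (-π) π :=
    (hWi _ _).continuousOn_mul hp.abs.continuousOn
  have h1 : IntervalIntegrable (fun t => (|p t| * W t + p t * W t) / 2 - R * W t - κ * B)
      volume (-π) π :=
    (((hapW.add hpW).div_const 2).sub ((hWi _ _).const_mul R)).sub intervalIntegrable_const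
  have h2 : IntervalIntegrable (fun t => p t * positivePartDensity p W R κ t) volume (-π) π :=
    (intervalIntegrable_positivePartDensity hp hWi hR _ _).continuousOn_mul hp.continuousOn
  have hle := intervalIntegral.integral_mono_on (by linarith [pi_pos]) h1 h2 fun t _ => ?_
  · rw [intervalIntegral.integral_sub (((hapW.add hpW).div_const 2).sub ((hWi _ _).const_mul R))
        intervalIntegrable_const,
      intervalIntegral.integral_sub ((hapW.add hpW).div_const 2) ((hWi _ _).const_mul R),
      intervalIntegral.integral_div, intervalIntegral.integral_add hapW hpW, hmean,
      intervalIntegral.integral_const_mul, intervalIntegral.integral_const, smul_eq_mul] at hle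
    linarith
  · have hκB : -(κ * B) ≤ p t * κ := by
      have := mul_le_mul_of_nonneg_left (hB t) hκ
      have := mul_le_mul_of_nonneg_left (neg_abs_le (p t)) hκ
      linarith
    have hpos : (|p t| + p t) / 2 - R ≤ p t * (max (p t) 0 / (max (p t) 0 + R)) := by
      rcases le_total (p t) 0 with h | h
      · rw [max_eq_right h, abs_of_nonpos h]; simp [hR.le]
      · rw [max_eq_left h, abs_of_nonneg h, ← mul_div_assoc, le_div_iff₀ (by positivity)]
        nlinarith
    have := mul_le_mul_of_nonneg_right hpos (hW0 t)
    unfold positivePartDensity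
    linarith

/-- The midpoint quantiles of `positivePartDensity` have a positive sum of values. -/
theorem sum_quantiles_pos (hp : ContDiff ℝ 1 p) (hW0 : ∀ t, 0 ≤ W t)
    (hWi : ∀ u v, IntervalIntegrable W volume u v) (hI : 0 < ∫ t in (-π)..π, W t)
    (hmean : ∫ t in (-π)..π, p t * W t = 0) (hK : 0 < ∫ t in (-π)..π, |p t| * W t)
    {N : ℕ} (hN : 0 < N) {M ϑ : ℝ}
    (hsup : ∀ t, |p t| ≤ M * ∫ t in (-π)..π, |p t| * W t)
    (hvar : ∫ t in (-π)..π, |deriv p t| ≤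
      ϑ * (N / ∫ t in (-π)..π, W t) * ∫ t in (-π)..π, |p t| * W t)
    (hR : R = (1 - ϑ) / (8 * ∫ t in (-π)..π, W t) * ∫ t in (-π)..π, |p t| * W t)
    (hM : 0 ≤ M) (hϑ1 : ϑ < 1)
    (hκ : κ = (1 - ϑ) / (8 * (2 * π * (M + 1 / ∫ t in (-π)..π, W t))))
    {q : ℕ → ℝ} (hq0 : q 0 = -π) (hqN : q (2 * N) = π) (hq : Monotone q)
    (hδ : ∀ k, ∫ t in (q k)..(q (k + 1)), positivePartDensity p W R κ t =
      (∫ t in (-π)..π, positivePartDensity p W R κ t) / (2 * N)) :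
    0 < ∑ i ∈ Finset.range N, p (q (2 * i + 1)) := by
  set I := ∫ t in (-π)..π, W t
  set K := ∫ t in (-π)..π, |p t| * W t
  set Z := ∫ t in (-π)..π, positivePartDensity p W R κ t with hZ
  have hϑ : 0 < 1 - ϑ := by linarith
  have hR0 : 0 < R := by rw [hR]; positivity
  have hκ0 : 0 < κ := by rw [hκ]; positivity
  have hρint := intervalIntegrable_positivePartDensity (κ := κ) hp.continuous hWi hR0
  have hN' : (0 : ℝ) < N := by exact_mod_cast hN
  have hquad := abs_integral_mul_sub_sum_quantiles_le (N := N) hp hρint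
    (fun t => hκ0.le.trans (le_positivePartDensity hW0 hR0 t)) hq hδ
  rw [hq0, hqN] at hquad
  have hlow := le_integral_mul_positivePartDensity hp.continuous hW0 hWi hmean hR0 hκ0.le hsup
  have hZ0 : 0 ≤ Z := intervalIntegral.integral_nonneg (by linarith [pi_pos])
    fun t _ => hκ0.le.trans (le_positivePartDensity hW0 hR0 t)
  have hZle : Z ≤ I + 2 * π * κ := by
    have := intervalIntegral.integral_mono_on (by linarith [pi_pos]) (hρint (-π) π)
      ((hWi (-π) π).add (intervalIntegrable_const (c := κ)))
      fun t _ => positivePartDensity_le (κ := κ) hW0 hR0 t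
    rw [intervalIntegral.integral_add (hWi _ _) intervalIntegrable_const,
      intervalIntegral.integral_const, smul_eq_mul] at this
    linarith
  have hvar' : Z / (2 * N) * ∫ t in (-π)..π, |deriv p t| ≤
      (I + 2 * π * κ) / (2 * N) * (ϑ * (N / I) * K) := by
    have h0 : 0 ≤ ∫ t in (-π)..π, |deriv p t| :=
      intervalIntegral.integral_nonneg (by linarith [pi_pos]) fun _ _ => abs_nonneg _
    gcongr
  have hsimp : (I + 2 * π * κ) / (2 * N) * (ϑ * (N / I) * K) =
      ϑ / 2 * K + ϑ * K / 2 * (2 * π * κ / I) := by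
    field_simp
  have hκI : 2 * π * κ * M + 2 * π * κ / I = (1 - ϑ) / 8 := by
    rw [hκ]; field_simp
  have hκI0 : 0 ≤ 2 * π * κ / I := by positivity
  have hRI : R * I = (1 - ϑ) / 8 * K := by rw [hR]; field_simp
  have hϑκ : ϑ * K / 2 * (2 * π * κ / I) ≤ K * (2 * π * κ / I) := by
    gcongr
    nlinarith
  have hKκ : K * (2 * π * κ * M) + K * (2 * π * κ / I) = K * ((1 - ϑ) / 8) := by
    rw [← mul_add, hκI]
  have hpos : 0 < 2 * (Z / (2 * N)) * ∑ i ∈ Finset.range N, p (q (2 * i + 1)) := by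
    have := (abs_le.mp hquad).2
    have hKϑ : 0 < K * (1 - ϑ) := by positivity
    linarith
  exact pos_of_mul_pos_right hpos (by positivity)

end

/-- If every function in a finite-dimensional space has small variation compared to its weighted
`L¹` norm, then some `N` points annihilate the whole space. -/
theorem exists_nodes_sum_eq_zero {V : Submodule ℝ (ℝ → ℝ)} [FiniteDimensional ℝ V] {W : ℝ → ℝ}
    (hW0 : ∀ t, 0 ≤ W t) (hWi : ∀ u v, IntervalIntegrable W volume u v)
    (hI : 0 < ∫ t in (-π)..π, W t) {N : ℕ} (hN : 0 < N) {M ϑ : ℝ} (hM : 0 ≤ M) (hϑ1 : ϑ < 1)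
    (hV : ∀ p ∈ V, ContDiff ℝ 1 p) (hmean : ∀ p ∈ V, ∫ t in (-π)..π, p t * W t = 0)
    (hsup : ∀ p ∈ V, ∀ t, |p t| ≤ M * ∫ t in (-π)..π, |p t| * W t)
    (hvar : ∀ p ∈ V, ∫ t in (-π)..π, |deriv p t| ≤
      ϑ * (N / ∫ t in (-π)..π, W t) * ∫ t in (-π)..π, |p t| * W t) :
    ∃ x : Fin N → ℝ, ∀ p ∈ V, ∑ j, p (x j) = 0 := by
  have hπ : -π ≤ π := by linarith [pi_pos]
  let b := Module.finBasis ℝ V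
  let E := EuclideanSpace ℝ (Fin (Module.finrank ℝ V))
  let P : E → V := fun c => ∑ i, c i • b i
  let p : E → ℝ → ℝ := fun c => (P c : ℝ → ℝ)
  have hpV : ∀ c, p c ∈ V := fun c => (P c).2
  have hp_apply : ∀ c t, p c t = ∑ i, c i * (b i : ℝ → ℝ) t := by
    intro c t
    simp [p, P, Finset.sum_apply]
  have hbc : ∀ i, Continuous (b i : ℝ → ℝ) := fun i => (hV _ (b i).2).continuous
  have hpc : ∀ c, Continuous (p c) := fun c => (hV _ (hpV c)).continuous
  have hpt : ∀ t, Continuous fun c => p c t := by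
    intro t
    simp_rw [hp_apply]
    exact continuous_finsetSum _ fun i _ =>
      (PiLp.continuous_apply 2 (fun _ => ℝ) i).mul continuous_const
  have hp0 : ∀ c, p c = 0 → c = 0 := by
    intro c hc
    have h0 : ∑ i, c i • b i = 0 := Subtype.ext hc
    have h1 := Fintype.linearIndependent_iff.mp b.linearIndependent (fun i => c i) h0
    exact (WithLp.ofLp_eq_zero 2).mp (funext h1)
  let K : E → ℝ := fun c => ∫ t in (-π)..π, |p c t| * W t
  have hK0 : ∀ c, 0 ≤ K c := fun c => intervalIntegral.integral_nonneg hπ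
    fun t _ => mul_nonneg (abs_nonneg _) (hW0 t)
  have hKpos : ∀ c, c ≠ 0 → 0 < K c := by
    intro c hc
    refine (hK0 c).lt_of_ne fun h => hc (hp0 c ?_)
    funext t
    have := hsup _ (hpV c) t
    rw [show ∫ t in (-π)..π, |p c t| * W t = 0 from h.symm, mul_zero] at this
    exact abs_nonpos_iff.mp this
  have hKc : Continuous K := by
    refine continuous_iff_continuousAt.mpr fun c₀ => ?_
    refine intervalIntegral.continuousAt_of_dominated_interval
      (bound := fun t => (∑ i, (‖c₀‖ + 1) * |(b i : ℝ → ℝ) t|) * W t) ?_ ?_ ?_ ?_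
    · refine Filter.Eventually.of_forall fun c => ?_
      exact ((hWi (-π) π).continuousOn_mul (hpc c).abs.continuousOn).def'.aestronglyMeasurable
    · filter_upwards [Metric.ball_mem_nhds c₀ one_pos] with c hc
      refine Filter.Eventually.of_forall fun t _ => ?_
      rw [Real.norm_of_nonneg (mul_nonneg (abs_nonneg _) (hW0 t)), hp_apply]
      refine mul_le_mul_of_nonneg_right ((Finset.abs_sum_le_sum_abs _ _).trans ?_) (hW0 t)
      refine Finset.sum_le_sum fun i _ => ?_
      rw [abs_mul]
      refine mul_le_mul_of_nonneg_right ?_ (abs_nonneg _)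
      have h1 : ‖c i‖ ≤ ‖c‖ := PiLp.norm_apply_le c i
      have h2 := norm_le_norm_add_norm_sub' c c₀
      have h3 : ‖c - c₀‖ < 1 := by rwa [← dist_eq_norm]
      rw [Real.norm_eq_abs] at h1
      linarith
    · exact (hWi _ _).continuousOn_mul (Continuous.continuousOn (by fun_prop))
    · exact Filter.Eventually.of_forall fun t _ => ((hpt t).abs.mul continuous_const).continuousAt
  set I := ∫ t in (-π)..π, W t
  have hϑ : 0 < 1 - ϑ := by linarith
  set κ := (1 - ϑ) / (8 * (2 * π * (M + 1 / I))) with hκdef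
  have hκ : 0 < κ := by positivity
  let R : E → ℝ := fun c => (1 - ϑ) / (8 * I) * (K c + max 0 (1 - ‖c‖))
  have hR : ∀ c, 0 < R c := by
    intro c
    have : 0 < K c + max 0 (1 - ‖c‖) := by
      by_cases hc : c = 0
      · have := hK0 c
        simp [hc] at this ⊢
        linarith
      · exact add_pos_of_pos_of_nonneg (hKpos c hc) (le_max_left _ _)
    positivity
  have hRc : Continuous R := by fun_prop
  let ρ : E → ℝ → ℝ := fun c => positivePartDensity (p c) W (R c) κ
  have hρi : ∀ c u v, IntervalIntegrable (ρ c) volume u v := fun c =>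
    intervalIntegrable_positivePartDensity (hpc c) hWi (hR c)
  let F : E → ℝ → ℝ := fun c t => ∫ s in (-π)..t, ρ c s
  have hFsub : ∀ c u v, F c v - F c u = ∫ s in u..v, ρ c s := fun c u v =>
    intervalIntegral.integral_interval_sub_left (hρi _ _ _) (hρi _ _ _)
  have hgrow : ∀ c u v, u ≤ v → κ * (v - u) ≤ F c v - F c u := by
    intro c u v huv
    rw [hFsub, mul_comm, ← smul_eq_mul, ← intervalIntegral.integral_const]
    exact intervalIntegral.integral_mono_on huv intervalIntegrable_const (hρi c u v)
      fun t _ => le_positivePartDensity hW0 (hR c) t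
  have hFt : ∀ c, Continuous (F c) := fun c =>
    intervalIntegral.continuous_primitive (hρi c) _
  have hFc : ∀ t, Continuous fun c => F c t := by
    intro t
    refine intervalIntegral.continuous_of_dominated_interval (bound := fun s => W s + κ)
      (fun c => (hρi c _ _).def'.aestronglyMeasurable) (fun c => ?_)
      ((hWi _ _).add intervalIntegrable_const) ?_
    · refine Filter.Eventually.of_forall fun s _ => ?_
      rw [Real.norm_of_nonneg (hκ.le.trans (le_positivePartDensity hW0 (hR c) s))]
      exact positivePartDensity_le hW0 (hR c) s
    · refine Filter.Eventually.of_forall fun s _ => ?_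
      have hm : Continuous fun c => max (p c s) 0 := (hpt s).max continuous_const
      refine ((hm.div (hm.add hRc) fun c => ?_).mul continuous_const).add continuous_const
      have h : 0 ≤ max (p c s) 0 := le_max_right _ _
      exact (add_pos_of_nonneg_of_pos h (hR c)).ne'
  have hlevel : ∀ k : ℕ, ∃ Q : E → ℝ, Continuous Q ∧
      ∀ c, F c (Q c) = k * (F c π / (2 * N)) := fun k =>
    exists_continuous_level hκ hgrow hFt hFc (by have := hFc π; fun_prop)
  choose Q hQc hQ using hlevel
  have hmonoF : ∀ c, StrictMono (F c) := by
    intro c u v huv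
    have := hgrow c u v huv.le
    have := mul_pos hκ (sub_pos.mpr huv)
    linarith
  have hN' : (0 : ℝ) < N := by exact_mod_cast hN
  have hFπ : ∀ c, 0 ≤ F c π := by
    intro c
    have h1 := (hmonoF c).monotone hπ
    have h2 : F c (-π) = 0 := intervalIntegral.integral_same
    linarith
  have hpos : ∀ c, 1 ≤ ‖c‖ → 0 < ∑ i ∈ Finset.range N, p c (Q (2 * i + 1) c) := by
    intro c hc
    have hc0 : c ≠ 0 := by
      rintro rfl
      rw [norm_zero] at hc
      linarith
    refine sum_quantiles_pos (q := fun k => Q k c) (W := W) (R := R c) (κ := κ)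
      (hV _ (hpV c)) hW0 hWi hI (hmean _ (hpV c)) (hKpos c hc0) hN (hsup _ (hpV c))
      (hvar _ (hpV c)) ?_ hM hϑ1 hκdef ?_ ?_ ?_ ?_
    · simp only [R]
      rw [max_eq_left (by linarith), add_zero]
    · refine (hmonoF c).injective ?_
      rw [hQ]
      simp [F]
    · refine (hmonoF c).injective ?_
      simp only [hQ]
      push_cast
      field_simp
    · intro k l hkl
      refine (hmonoF c).le_iff_le.mp ?_
      simp only [hQ]
      have := hFπ c
      gcongr
    · intro k
      change ∫ t in (Q k c)..(Q (k + 1) c), ρ c t = F c π / (2 * N)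
      rw [← hFsub, hQ, hQ]
      push_cast
      ring
  let G : E → E := fun c =>
    WithLp.toLp 2 fun i => ∑ j ∈ Finset.range N, (b i : ℝ → ℝ) (Q (2 * j + 1) c)
  have hGc : Continuous G := by
    refine (PiLp.continuous_toLp 2 _).comp (continuous_pi fun i => ?_)
    exact continuous_finsetSum _ fun j _ => (hbc i).comp (hQc _)
  obtain ⟨c, hc⟩ := exists_zero_of_inner_pos hGc fun c hc => by
    have : inner ℝ (G c) c = ∑ i ∈ Finset.range N, p c (Q (2 * i + 1) c) := by
      simp_rw [hp_apply]
      rw [Finset.sum_comm, PiLp.inner_apply]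
      refine Finset.sum_congr rfl fun i _ => ?_
      simp [G, Finset.mul_sum]
    rw [this]
    exact hpos c hc
  refine ⟨fun j => Q (2 * j + 1) c, fun f hf => ?_⟩
  have hzero : ∀ i, ∑ j : Fin N, (b i : ℝ → ℝ) (Q (2 * j + 1) c) = 0 := by
    intro i
    have := congrArg (fun v : E => v i) hc
    simpa [G, Finset.sum_range] using this
  have hrepr := congrArg (fun v : V => (v : ℝ → ℝ)) (b.sum_repr ⟨f, hf⟩)
  simp only at hrepr
  have hf_apply : ∀ t, f t = ∑ i, b.repr ⟨f, hf⟩ i * (b i : ℝ → ℝ) t := by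
    intro t
    rw [← congrFun hrepr t]
    simp only [Submodule.coe_sum, Submodule.coe_smul, Finset.sum_apply, Pi.smul_apply, smul_eq_mul]
  simp_rw [hf_apply]
  rw [Finset.sum_comm]
  simp_rw [← Finset.mul_sum, hzero, mul_zero, Finset.sum_const_zero]

/-- The trigonometric polynomials of degree at most `n`, as the span of phase-shifted cosines. -/
def trigSpace (n : ℕ) : Submodule ℝ (ℝ → ℝ) :=
  Submodule.span ℝ {f | ∃ k ≤ n, ∃ y : ℝ, f = fun t => Real.cos (k * t + y)}

theorem cos_mem_trigSpace {n k : ℕ} (hk : k ≤ n) (y : ℝ) :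
    (fun t : ℝ => Real.cos (k * t + y)) ∈ trigSpace n :=
  Submodule.subset_span ⟨k, hk, y, rfl⟩

theorem const_mem_trigSpace (n : ℕ) (c : ℝ) : (fun _ : ℝ => c) ∈ trigSpace n := by
  have := (trigSpace n).smul_mem c (cos_mem_trigSpace (Nat.zero_le n) 0)
  convert! this using 1
  funext t
  simp

theorem IsTrigPoly.mem_trigSpace {n : ℕ} {p : ℝ → ℝ} (hp : IsTrigPoly n p) : p ∈ trigSpace n := by
  obtain ⟨a, b, h⟩ := hp
  have : p = (fun _ => a 0) + ∑ k ∈ Finset.Icc 1 n,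
      (a k • (fun t : ℝ => Real.cos (k * t + 0)) +
        b k • fun t : ℝ => Real.cos (k * t + -(π / 2))) := by
    funext t
    rw [h t]
    simp [Finset.sum_apply, ← sub_eq_add_neg, Real.cos_sub_pi_div_two]
  rw [this]
  refine (trigSpace n).add_mem (const_mem_trigSpace n _) ((trigSpace n).sum_mem fun k hk => ?_)
  have hk := (Finset.mem_Icc.mp hk).2
  exact (trigSpace n).add_mem ((trigSpace n).smul_mem _ (cos_mem_trigSpace hk _))
    ((trigSpace n).smul_mem _ (cos_mem_trigSpace hk _))

instance finiteDimensional_trigSpace (n : ℕ) : FiniteDimensional ℝ (trigSpace n) := by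
  let g : Fin (n + 1) ⊕ Fin (n + 1) → ℝ → ℝ :=
    Sum.elim (fun k t => Real.cos ((k : ℕ) * t)) (fun k t => Real.sin ((k : ℕ) * t))
  have : FiniteDimensional ℝ (Submodule.span ℝ (Set.range g)) :=
    FiniteDimensional.span_of_finite ℝ (Set.finite_range g)
  refine Submodule.finiteDimensional_of_le (S₂ := Submodule.span ℝ (Set.range g))
    (Submodule.span_le.mpr ?_)
  rintro _ ⟨k, hk, y, rfl⟩
  have h1 : g (.inl ⟨k, by omega⟩) ∈ Submodule.span ℝ (Set.range g) :=
    Submodule.subset_span ⟨_, rfl⟩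
  have h2 : g (.inr ⟨k, by omega⟩) ∈ Submodule.span ℝ (Set.range g) :=
    Submodule.subset_span ⟨_, rfl⟩
  convert! Submodule.sub_mem _ (Submodule.smul_mem _ (Real.cos y) h1)
    (Submodule.smul_mem _ (Real.sin y) h2) using 1
  funext t
  simp only [g, Sum.elim_inl, Sum.elim_inr, Pi.sub_apply, Pi.smul_apply, smul_eq_mul,
    Real.cos_add]
  ring

section
variable {n : ℕ} {p : ℝ → ℝ}

theorem contDiff_of_mem_trigSpace (hp : p ∈ trigSpace n) : ContDiff ℝ 1 p := by
  induction hp using Submodule.span_induction with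
  | mem f hf =>
    obtain ⟨k, -, y, rfl⟩ := hf
    fun_prop
  | zero => exact contDiff_const
  | add f g _ _ hf hg => exact hf.add hg
  | smul c f _ hf => exact contDiff_const.smul hf

theorem periodic_of_mem_trigSpace (hp : p ∈ trigSpace n) : Function.Periodic p (2 * π) := by
  induction hp using Submodule.span_induction with
  | mem f hf =>
    obtain ⟨k, -, y, rfl⟩ := hf
    intro t
    have := Real.cos_add_nat_mul_two_pi (k * t + y) k
    simp only
    rw [← this]
    congr 1
    ring
  | zero => exact fun _ => rfl
  | add f g _ _ hf hg => exact hf.add hg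
  | smul c f _ hf => exact hf.smul c

theorem integral_cos_int_mul_add (m : ℤ) (y : ℝ) :
    ∫ t in (-π)..π, Real.cos (m * t + y) = if m = 0 then 2 * π * Real.cos y else 0 := by
  split_ifs with h
  · subst h
    simp only [Int.cast_zero, zero_mul, zero_add, intervalIntegral.integral_const, smul_eq_mul]
    ring
  · have hm : (m : ℝ) ≠ 0 := by exact_mod_cast h
    rw [intervalIntegral.integral_comp_mul_add _ hm, integral_cos]
    have : Real.sin (m * π + y) = Real.sin (m * -π + y) := by
      rw [← Real.sin_add_int_mul_two_pi (m * -π + y) m]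
      congr 1
      ring
    simp [this]

/-- The Dirichlet kernel reproduces trigonometric polynomials. -/
theorem integral_mul_dirichletKernel (hp : p ∈ trigSpace n) (x : ℝ) :
    ∫ t in (-π)..π, p t * ∑ k ∈ Finset.Icc (-n : ℤ) n, Real.cos (k * (x - t)) = 2 * π * p x := by
  have hD : Continuous fun t : ℝ => ∑ k ∈ Finset.Icc (-n : ℤ) n, Real.cos (k * (x - t)) := by
    fun_prop
  induction hp using Submodule.span_induction with
  | mem f hf =>
    obtain ⟨m, hm, y, rfl⟩ := hf
    have hterm : ∀ k : ℤ, ∫ t in (-π)..π, Real.cos (m * t + y) * Real.cos (k * (x - t)) =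
        (if k = m then π * Real.cos (m * x + y) else 0) +
          (if k = -m then π * Real.cos (m * x + y) else 0) := by
      intro k
      have h : ∀ t : ℝ, Real.cos (m * t + y) * Real.cos (k * (x - t)) =
          1 / 2 * Real.cos (((m - k : ℤ) : ℝ) * t + (y + k * x)) +
          1 / 2 * Real.cos (((m + k : ℤ) : ℝ) * t + (y - k * x)) := by
        intro t
        have h1 : ((m - k : ℤ) : ℝ) * t + (y + k * x) = (m * t + y) + k * (x - t) := by
          push_cast; ring
        have h2 : ((m + k : ℤ) : ℝ) * t + (y - k * x) = (m * t + y) - k * (x - t) := by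
          push_cast; ring
        rw [h1, h2, Real.cos_add (m * t + y), Real.cos_sub (m * t + y)]
        ring
      simp_rw [h]
      rw [intervalIntegral.integral_add (Continuous.intervalIntegrable (by fun_prop) _ _)
        (Continuous.intervalIntegrable (by fun_prop) _ _), intervalIntegral.integral_const_mul,
        intervalIntegral.integral_const_mul, integral_cos_int_mul_add, integral_cos_int_mul_add]
      congr 1
      · by_cases hk : k = m
        · subst hk
          simp
          ring_nf
        · rw [if_neg (by omega), if_neg hk, mul_zero]
      · by_cases hk : k = -m
        · subst hk
          simp
          ring_nf
        · rw [if_neg (by omega), if_neg hk, mul_zero]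
    simp_rw [Finset.mul_sum]
    rw [intervalIntegral.integral_finsetSum
      fun k _ => Continuous.intervalIntegrable (by fun_prop) _ _]
    simp_rw [hterm]
    rw [Finset.sum_add_distrib, Finset.sum_ite_eq', Finset.sum_ite_eq', if_pos, if_pos]
    · ring
    · rw [Finset.mem_Icc]; omega
    · rw [Finset.mem_Icc]; omega
  | zero => simp
  | add f g hf hg ihf ihg =>
    have hfc := (contDiff_of_mem_trigSpace hf).continuous
    have hgc := (contDiff_of_mem_trigSpace hg).continuous
    simp_rw [Pi.add_apply, add_mul]
    rw [intervalIntegral.integral_add (Continuous.intervalIntegrable (by fun_prop) _ _)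
      (Continuous.intervalIntegrable (by fun_prop) _ _), ihf, ihg]
    ring
  | smul c f _ ihf =>
    simp_rw [Pi.smul_apply, smul_eq_mul, mul_assoc]
    rw [intervalIntegral.integral_const_mul, ihf]
    ring

/-- Nikolskii's inequality between the supremum norm and the `L¹` norm. -/
theorem abs_le_integral_abs_of_mem_trigSpace (hp : p ∈ trigSpace n) (x : ℝ) :
    |p x| ≤ (2 * n + 1) / (2 * π) * ∫ t in (-π)..π, |p t| := by
  have hπ : -π ≤ π := by linarith [pi_pos]
  have hc := (contDiff_of_mem_trigSpace hp).continuous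
  have h1 : |2 * π * p x| ≤ ∫ t in (-π)..π, |p t| * (2 * n + 1) := by
    rw [← integral_mul_dirichletKernel hp x]
    refine (intervalIntegral.abs_integral_le_integral_abs hπ).trans ?_
    refine intervalIntegral.integral_mono_on hπ
      (Continuous.intervalIntegrable (by fun_prop) _ _)
      (Continuous.intervalIntegrable (by fun_prop) _ _) fun t _ => ?_
    rw [abs_mul]
    refine mul_le_mul_of_nonneg_left ?_ (abs_nonneg _)
    refine (Finset.abs_sum_le_sum_abs _ _).trans
      ((Finset.sum_le_sum fun k _ => Real.abs_cos_le_one _).trans ?_)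
    rw [Finset.sum_const, Int.card_Icc, nsmul_one]
    have : (n + 1 - -(n : ℤ)).toNat = 2 * n + 1 := by omega
    rw [this]
    push_cast
    exact le_rfl
  rw [intervalIntegral.integral_mul_const, abs_mul, abs_of_pos (by positivity)] at h1
  rw [div_mul_eq_mul_div, le_div_iff₀ (by positivity)]
  linarith

theorem hasSum_sin_mul_sin_div_sq {s : ℝ} (hs0 : 0 ≤ s) (hs1 : s ≤ 1) :
    HasSum (fun k : ℕ => Real.sin (π / 2 * k) / k ^ 2 * Real.sin (π / 2 * k * s))
      (π ^ 2 / 8 * s) := by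
  have hB : ∀ x : ℝ, ((-1 : ℝ) ^ (1 + 1) * (2 * π) ^ (2 * 1) / 2 / (2 * 1).factorial *
      (Polynomial.map (algebraMap ℚ ℝ) (Polynomial.bernoulli (2 * 1))).eval x) =
      π ^ 2 * (x ^ 2 - x + 1 / 6) := by
    intro x
    simp [Polynomial.bernoulli, Finset.sum_range_succ, bernoulli_eq_bernoulli'_of_ne_one]
    ring
  have h1 := hasSum_one_div_nat_pow_mul_cos one_ne_zero
    (x := (1 - s) / 4) ⟨by linarith, by linarith⟩
  have h2 := hasSum_one_div_nat_pow_mul_cos one_ne_zero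
    (x := (1 + s) / 4) ⟨by linarith, by linarith⟩
  rw [hB] at h1 h2
  convert! (h1.sub h2).mul_left (1 / 2) using 1
  · funext k
    have e1 : 2 * π * k * ((1 - s) / 4) = π / 2 * k - π / 2 * k * s := by ring
    have e2 : 2 * π * k * ((1 + s) / 4) = π / 2 * k + π / 2 * k * s := by ring
    rw [e1, e2, Real.cos_add (π / 2 * k), Real.cos_sub (π / 2 * k)]
    ring
  · ring

theorem hasSum_abs_sin_div_sq :
    HasSum (fun k : ℕ => |Real.sin (π / 2 * k) / k ^ 2|) (π ^ 2 / 8) := by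
  convert! hasSum_sin_mul_sin_div_sq zero_le_one le_rfl using 1
  · funext k
    have h : Real.sin (π / 2 * k) * Real.cos (π / 2 * k) = 0 := by
      have := Real.sin_two_mul (π / 2 * k)
      rw [show 2 * (π / 2 * k) = k * π by ring, Real.sin_nat_mul_pi] at this
      linarith
    have habs : |Real.sin (π / 2 * k)| = Real.sin (π / 2 * k) * Real.sin (π / 2 * k) := by
      rcases mul_eq_zero.mp h with h | h
      · simp only [h, abs_zero, mul_zero]
      · have hsq := Real.sin_sq_add_cos_sq (π / 2 * k)
        rw [h, zero_pow two_ne_zero, add_zero] at hsq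
        rw [← sq, hsq, ← sq_eq_sq₀ (abs_nonneg _) zero_le_one, sq_abs, hsq, one_pow]
    rw [mul_one, abs_div, abs_of_nonneg (sq_nonneg (k : ℝ)), habs]
    ring
  · ring

/-- A Riesz-type interpolation formula for the derivative of a trigonometric polynomial. -/
theorem hasSum_deriv_of_mem_trigSpace (hn : 1 ≤ n) (hp : p ∈ trigSpace n) (x : ℝ) :
    HasSum (fun k : ℕ => Real.sin (π / 2 * k) / k ^ 2 *
      (p (x + π / 2 * k / n) - p (x - π / 2 * k / n))) (π ^ 2 / (4 * n) * deriv p x) := by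
  have hn0 : (0 : ℝ) < n := by exact_mod_cast hn
  induction hp using Submodule.span_induction with
  | mem f hf =>
    obtain ⟨m, hm, y, rfl⟩ := hf
    have hm' : (m : ℝ) ≤ n := by exact_mod_cast hm
    have hd : deriv (fun t : ℝ => Real.cos (m * t + y)) x = -(m * Real.sin (m * x + y)) := by
      have : HasDerivAt (fun t : ℝ => Real.cos (m * t + y)) (-Real.sin (m * x + y) * (m * 1)) x :=
        (((hasDerivAt_id' x).const_mul (m : ℝ)).add_const y).cos
      rw [this.deriv]
      ring
    convert! (hasSum_sin_mul_sin_div_sq (s := m / n) (by positivity)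
      ((div_le_one hn0).mpr hm')).mul_left (-2 * Real.sin (m * x + y)) using 1
    · funext k
      have e1 : m * (x + π / 2 * k / n) + y = (m * x + y) + π / 2 * k * (m / n) := by ring
      have e2 : m * (x - π / 2 * k / n) + y = (m * x + y) - π / 2 * k * (m / n) := by ring
      simp only
      rw [e1, e2, Real.cos_add (m * x + y), Real.cos_sub (m * x + y)]
      ring
    · rw [hd]
      field_simp
      ring
  | zero =>
    convert! hasSum_zero (α := ℝ) (β := ℕ) using 1
    · funext k; simp
    · simp
  | add f g hf hg ihf ihg =>
    have hfd := ((contDiff_of_mem_trigSpace hf).differentiable one_ne_zero) x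
    have hgd := ((contDiff_of_mem_trigSpace hg).differentiable one_ne_zero) x
    rw [deriv_add hfd hgd, mul_add]
    convert! ihf.add ihg using 1
    funext k
    simp only [Pi.add_apply]
    ring
  | smul c f hf ihf =>
    have hfd := ((contDiff_of_mem_trigSpace hf).differentiable one_ne_zero) x
    rw [deriv_const_smul c hfd]
    convert! ihf.mul_left c using 1
    · funext k
      simp only [Pi.smul_apply, smul_eq_mul]
      ring
    · rw [smul_eq_mul]
      ring

/-- Bernstein's inequality in `L¹`. -/
theorem integral_abs_deriv_le_of_mem_trigSpace (hn : 1 ≤ n) (hp : p ∈ trigSpace n) :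
    ∫ t in (-π)..π, |deriv p t| ≤ n * ∫ t in (-π)..π, |p t| := by
  have hn0 : (0 : ℝ) < n := by exact_mod_cast hn
  have hπ : -π ≤ π := by linarith [pi_pos]
  have hc := (contDiff_of_mem_trigSpace hp).continuous
  have hdc : Continuous (deriv p) := (contDiff_of_mem_trigSpace hp).continuous_deriv le_rfl
  set B := (2 * n + 1) / (2 * π) * ∫ t in (-π)..π, |p t|
  have hB : ∀ t, |p t| ≤ B := abs_le_integral_abs_of_mem_trigSpace hp
  let c : ℕ → ℝ := fun k => Real.sin (π / 2 * k) / k ^ 2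
  let F : ℕ → ℝ → ℝ := fun k x => |c k| * (|p (x + π / 2 * k / n)| + |p (x - π / 2 * k / n)|)
  have hFc : ∀ k, Continuous (F k) := fun k => by fun_prop
  have hF0 : ∀ k x, 0 ≤ F k x := fun k x => by positivity
  have hFB : ∀ k x, ‖F k x‖ ≤ |c k| * (B + B) := by
    intro k x
    rw [Real.norm_of_nonneg (hF0 k x)]
    exact mul_le_mul_of_nonneg_left (add_le_add (hB _) (hB _)) (abs_nonneg _)
  have hcs : Summable fun k => |c k| * (B + B) := hasSum_abs_sin_div_sq.summable.mul_right _
  have hFs : ∀ x, Summable fun k => F k x := fun x =>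
    Summable.of_norm_bounded hcs fun k => hFB k x
  have hshift : ∀ s : ℝ, ∫ t in (-π)..π, |p (t + s)| = ∫ t in (-π)..π, |p t| := by
    intro s
    rw [intervalIntegral.integral_comp_add_right fun t => |p t|]
    have hper : Function.Periodic (fun t => |p t|) (2 * π) := fun t => by
      simp only [periodic_of_mem_trigSpace hp t]
    have := hper.intervalIntegral_add_eq (-π + s) (-π)
    rw [show -π + s + 2 * π = π + s by ring, show -π + 2 * π = π by ring] at this
    exact this
  have hFi : ∀ k, ∫ t in (-π)..π, F k t = |c k| * (2 * ∫ t in (-π)..π, |p t|) := by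
    intro k
    simp only [F]
    rw [intervalIntegral.integral_const_mul, intervalIntegral.integral_add
      (Continuous.intervalIntegrable (by fun_prop) _ _)
      (Continuous.intervalIntegrable (by fun_prop) _ _), hshift]
    simp_rw [sub_eq_add_neg]
    rw [hshift, two_mul]
  have hsum1 : HasSum (fun k => ∫ t in (-π)..π, F k t) (∫ t in (-π)..π, ∑' k, F k t) :=
    intervalIntegral.hasSum_integral_of_dominated_convergence (fun k _ => |c k| * (B + B))
      (fun k => (hFc k).aestronglyMeasurable) (fun k => .of_forall fun x _ => hFB k x)
      (.of_forall fun _ _ => hcs) intervalIntegrable_const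
      (.of_forall fun x _ => (hFs x).hasSum)
  have hsum2 : HasSum (fun k => ∫ t in (-π)..π, F k t)
      (π ^ 2 / 8 * (2 * ∫ t in (-π)..π, |p t|)) := by
    simp_rw [hFi]
    exact hasSum_abs_sin_div_sq.mul_right _
  have hle : ∫ t in (-π)..π, π ^ 2 / (4 * n) * |deriv p t| ≤ ∫ t in (-π)..π, ∑' k, F k t := by
    refine intervalIntegral.integral_mono_on hπ (Continuous.intervalIntegrable (by fun_prop) _ _)
      ((continuous_tsum hFc hcs hFB).intervalIntegrable _ _) fun t _ => ?_
    have h := hasSum_deriv_of_mem_trigSpace hn hp t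
    have habs : π ^ 2 / (4 * n) * |deriv p t| = |π ^ 2 / (4 * n) * deriv p t| := by
      rw [abs_mul, abs_of_pos (show 0 < π ^ 2 / (4 * n) by positivity)]
    rw [habs, ← h.tsum_eq, ← Real.norm_eq_abs]
    refine tsum_of_norm_bounded (hFs t).hasSum fun k => ?_
    rw [Real.norm_eq_abs, abs_mul]
    exact mul_le_mul_of_nonneg_left (abs_sub _ _) (abs_nonneg _)
  rw [hsum1.unique hsum2, intervalIntegral.integral_const_mul] at hle
  have h2 : 0 < π ^ 2 / (4 * n) := by positivity
  refine le_of_mul_le_mul_left (hle.trans_eq ?_) h2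
  field_simp
  ring

end

/-- A trigonometric polynomial cannot concentrate on a small set, so a weight bounded below off
such a set controls its `L¹` norm. -/
theorem mul_integral_abs_le_integral_abs_mul {n : ℕ} {p W : ℝ → ℝ} (hp : p ∈ trigSpace n)
    (hW0 : ∀ t, 0 ≤ W t) (hWi : IntervalIntegrable W volume (-π) π) {δ : ℝ} {D : Set ℝ}
    (hD : D ⊆ Icc (-π) π) (hDmeas : MeasurableSet D)
    (hDvol : (volume D).toReal ≤ δ * (2 * π) / (2 * n + 1))
    (hE : 0 ≤ essInf W (volume.restrict (Icc (-π) π \ D))) :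
    essInf W (volume.restrict (Icc (-π) π \ D)) * (1 - δ) * ∫ t in (-π)..π, |p t| ≤
      ∫ t in (-π)..π, |p t| * W t := by
  have hπ : -π ≤ π := by linarith [pi_pos]
  have hc := (contDiff_of_mem_trigSpace hp).continuous
  have hsup := abs_le_integral_abs_of_mem_trigSpace hp
  have hpWi : IntervalIntegrable (fun t => |p t| * W t) volume (-π) π :=
    hWi.continuousOn_mul hc.abs.continuousOn
  rw [intervalIntegrable_iff_integrableOn_Icc_of_le hπ] at hpWi
  have hpi : IntegrableOn (fun t => |p t|) (Icc (-π) π) := hc.abs.continuousOn.integrableOn_Icc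
  rw [intervalIntegral.integral_of_le hπ, ← integral_Icc_eq_integral_Ioc] at hsup ⊢
  rw [intervalIntegral.integral_of_le hπ, ← integral_Icc_eq_integral_Ioc]
  set J := ∫ t in Icc (-π) π, |p t|
  set e := essInf W (volume.restrict (Icc (-π) π \ D))
  have hJ : 0 ≤ J := integral_nonneg fun _ => abs_nonneg _
  have hDfin : volume D < ⊤ := (measure_mono hD).trans_lt measure_Icc_lt_top
  have hDint : ∫ t in D, |p t| ≤ δ * J := by
    have h1 := norm_setIntegral_le_of_norm_le_const (f := fun t => |p t|) hDfin
      (C := (2 * n + 1) / (2 * π) * J) fun t _ => by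
        rw [Real.norm_eq_abs, abs_abs]; exact hsup t
    refine (le_abs_self _).trans (h1.trans ?_)
    calc (2 * n + 1) / (2 * π) * J * volume.real D
        ≤ (2 * n + 1) / (2 * π) * J * (δ * (2 * π) / (2 * n + 1)) := by gcongr; exact hDvol
      _ = δ * J := by field_simp
  have hdiff : ∫ t in Icc (-π) π \ D, |p t| = J - ∫ t in D, |p t| :=
    setIntegral_sdiff hDmeas hpi hD
  have hae : ∀ᵐ t ∂volume.restrict (Icc (-π) π \ D), e ≤ W t :=
    ae_essInf_le ⟨0, Filter.eventually_map.mpr (.of_forall hW0)⟩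
  calc e * (1 - δ) * J ≤ e * ∫ t in Icc (-π) π \ D, |p t| := by
        rw [mul_assoc, hdiff]
        gcongr
        linarith
    _ = ∫ t in Icc (-π) π \ D, |p t| * e := by rw [integral_mul_const, mul_comm]
    _ ≤ ∫ t in Icc (-π) π \ D, |p t| * W t := by
        refine integral_mono_ae ((hpi.mono_set sdiff_subset).mul_const e)
          (hpWi.mono_set sdiff_subset) ?_
        filter_upwards [hae] with t ht
        exact mul_le_mul_of_nonneg_left ht (abs_nonneg _)
    _ ≤ ∫ t in Icc (-π) π, |p t| * W t :=
        setIntegral_mono_set hpWi (.of_forall fun t => mul_nonneg (abs_nonneg _) (hW0 t))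
          (LE.le.eventuallyLE sdiff_subset)

/-- The functions of `trigSpace n` with vanishing weighted integral. -/
def meanZeroTrigSpace (n : ℕ) {W : ℝ → ℝ} (hWi : IntervalIntegrable W volume (-π) π) :
    Submodule ℝ (ℝ → ℝ) where
  carrier := {p | p ∈ trigSpace n ∧ ∫ t in (-π)..π, p t * W t = 0}
  zero_mem' := ⟨Submodule.zero_mem _, by simp⟩
  add_mem' := by
    rintro f g ⟨hf, hf0⟩ ⟨hg, hg0⟩
    refine ⟨Submodule.add_mem _ hf hg, ?_⟩
    have hfi := hWi.continuousOn_mul (contDiff_of_mem_trigSpace hf).continuous.continuousOn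
    have hgi := hWi.continuousOn_mul (contDiff_of_mem_trigSpace hg).continuous.continuousOn
    simp_rw [Pi.add_apply, add_mul]
    rw [intervalIntegral.integral_add hfi hgi, hf0, hg0, add_zero]
  smul_mem' := by
    rintro c f ⟨hf, hf0⟩
    refine ⟨Submodule.smul_mem _ c hf, ?_⟩
    simp_rw [Pi.smul_apply, smul_eq_mul, mul_assoc]
    rw [intervalIntegral.integral_const_mul, hf0, mul_zero]

theorem general_upper_bound_trig (n : ℕ) (hn : 1 ≤ n)
    (W : ℝ → ℝ) (hW : IsPeriodicWeight W)
    (η : ℝ) (hη0 : 0 < η) (hη1 : η < 1)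
    (D : Set ℝ) (hD : D ⊆ Icc (-π) π) (hDmeas : MeasurableSet D)
    (hDvol : (volume D).toReal ≤ (1 - η) ^ 2 * (2 * π) / (2 * n + 1))
    (hE : 0 < essInf W (volume.restrict (Icc (-π) π \ D)))
    (N : ℕ)
    (hN : (1 / η) * ((∫ θ in (-π)..π, W θ) / essInf W (volume.restrict (Icc (-π) π \ D))) * n
      ≤ N) :
    ∃ θs : Fin N → ℝ, IsTrigChebQuad W n N θs := by
  obtain ⟨-, hW0, hper, hWi, hI⟩ := hW
  have hn0 : (0 : ℝ) < n := by exact_mod_cast hn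
  have hWi' : ∀ u v, IntervalIntegrable W volume u v := fun u v =>
    hper.intervalIntegrable two_pi_pos.ne' (t := -π)
      (by rwa [show -π + 2 * π = π by ring]) u v
  have hL1 : ∀ p ∈ trigSpace n, _ := fun p hp =>
    mul_integral_abs_le_integral_abs_mul hp hW0 hWi hD hDmeas hDvol hE.le
  rw [show 1 - (1 - η) ^ 2 = η * (2 - η) by ring] at hL1
  set e := essInf W (volume.restrict (Icc (-π) π \ D))
  set I := ∫ t in (-π)..π, W t with hIdef
  have hη2 : 0 < 2 - η := by linarith
  have hNpos : (0 : ℝ) < N := lt_of_lt_of_le (by positivity) hN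
  have hfd : FiniteDimensional ℝ (meanZeroTrigSpace n hWi) :=
    Submodule.finiteDimensional_of_le (S₂ := trigSpace n) fun p hp => hp.1
  obtain ⟨x, hx⟩ := exists_nodes_sum_eq_zero (V := meanZeroTrigSpace n hWi) hW0 hWi' hI
    (N := N) (by exact_mod_cast hNpos) (M := (2 * n + 1) / (2 * π) / (e * (η * (2 - η))))
    (ϑ := 1 / (2 - η)) (by positivity) (by rw [div_lt_one hη2]; linarith)
    (fun p hp => contDiff_of_mem_trigSpace hp.1) (fun p hp => hp.2)
    (fun p hp t => by
      refine (abs_le_integral_abs_of_mem_trigSpace hp.1 t).trans ?_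
      rw [div_mul_eq_mul_div _ (e * (η * (2 - η))), le_div_iff₀ (by positivity), mul_assoc]
      gcongr
      linarith [hL1 p hp.1])
    (fun p hp => by
      refine (integral_abs_deriv_le_of_mem_trigSpace hn hp.1).trans ?_
      have h1 : n / (η * e) ≤ N / I := by
        rw [le_div_iff₀ hI]
        refine le_trans (le_of_eq ?_) hN
        field_simp
      have hK : 0 ≤ ∫ t in (-π)..π, |p t| * W t := intervalIntegral.integral_nonneg
        (by linarith [pi_pos]) fun t _ => mul_nonneg (abs_nonneg _) (hW0 t)
      calc n * ∫ t in (-π)..π, |p t|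
          = 1 / (2 - η) * (n / (η * e)) * (e * (η * (2 - η)) * ∫ t in (-π)..π, |p t|) := by
            field_simp
        _ ≤ 1 / (2 - η) * (n / (η * e)) * ∫ t in (-π)..π, |p t| * W t := by
            gcongr
            exact hL1 p hp.1
        _ ≤ 1 / (2 - η) * (N / I) * ∫ t in (-π)..π, |p t| * W t := by gcongr)
  refine ⟨x ∘ Tuple.sort x, Tuple.monotone_sort x, fun p hp => ?_⟩
  have hpT := hp.mem_trigSpace
  have hpi := hWi.continuousOn_mul (contDiff_of_mem_trigSpace hpT).continuous.continuousOn
  set m := ∫ t in (-π)..π, p t * W t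
  have h0 := hx (p - fun _ => m / I) ⟨Submodule.sub_mem _ hpT (const_mem_trigSpace n _), by
    simp_rw [Pi.sub_apply, sub_mul]
    rw [intervalIntegral.integral_sub hpi (hWi.const_mul _), intervalIntegral.integral_const_mul,
      ← hIdef, div_mul_cancel₀ _ hI.ne', sub_self]⟩
  simp only [Pi.sub_apply, Finset.sum_sub_distrib, Finset.sum_const, Finset.card_univ,
    Fintype.card_fin, nsmul_eq_mul] at h0
  rw [show ∑ i, p ((x ∘ Tuple.sort x) i) = ∑ i, p (x i) from
    Equiv.sum_comp (Tuple.sort x) fun i => p (x i), sub_eq_zero.mp h0, ← hIdef]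
  field_simp
end
end
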